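/- arXiv:2310.04807 — 2 statements merged into one kernel-verified Lean document; each statement's English description precedes it below -/
import Mathlib

section
/- (Lemma on stage errors, 1D case.) Assume the partition is quasi-uniform and τ ≤ C_CFL h^κ with κ ≥ 1. Then there is a constant C, independent of h, τ, and n (depending on k, s, r, the Runge–Kutta coefficients, β, γ, and Sobolev norms of u), such that for every 0 ≤ ℓ ≤ s−1: ‖ξ^{n,ℓ+1}‖_{L²(Ω)} ≤ C (Σ_{0≤m≤ℓ} ‖ξ_σ^{n,m}‖_{L²(Ω)}) + C τ (h^{k+1} + τ^r). -/
open Polynomial Finset MeasureTheory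

namespace OEDG

variable {N : ℕ}

/-- `pt` lists the nodes `x_{1/2} < x_{3/2} < … < x_{N+1/2}` of a partition of `Ω = [0,1]`. -/
def IsMesh (pt : Fin (N+1) → ℝ) : Prop :=
  pt 0 = 0 ∧ pt (Fin.last N) = 1 ∧ StrictMono pt

/-- Left endpoint of cell `j`. -/
def ptL (pt : Fin (N+1) → ℝ) (j : Fin N) : ℝ := pt j.castSucc

/-- Right endpoint of cell `j`. -/
def ptR (pt : Fin (N+1) → ℝ) (j : Fin N) : ℝ := pt j.succ

/-- Length `h_j` of cell `j`. -/
def cellh (pt : Fin (N+1) → ℝ) (j : Fin N) : ℝ := ptR pt j - ptL pt j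

/-- Maximal mesh size `h`. -/
noncomputable def meshSize (pt : Fin (N+1) → ℝ) : ℝ := ⨆ j : Fin N, cellh pt j

/-- Quasi-uniformity of the partition: `h ≤ γ h_j` for all `j`. -/
def QuasiUniform (pt : Fin (N+1) → ℝ) (γ : ℝ) : Prop :=
  ∀ j : Fin N, meshSize pt ≤ γ * cellh pt j

/-- Membership in `V^k`: every cell polynomial has degree at most `k`. -/
def MemVk (k : ℕ) (u : Fin N → Polynomial ℝ) : Prop :=
  ∀ j, (u j).natDegree ≤ k

/-- Cellwise `L²` inner product. -/
noncomputable def cip (pt : Fin (N+1) → ℝ) (j : Fin N) (p q : Polynomial ℝ) : ℝ :=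
  ∫ x in (ptL pt j)..(ptR pt j), p.eval x * q.eval x

/-- Global `L²(Ω)` inner product of piecewise polynomials. -/
noncomputable def ip (pt : Fin (N+1) → ℝ) (u v : Fin N → Polynomial ℝ) : ℝ :=
  ∑ j : Fin N, cip pt j (u j) (v j)

/-- Cellwise `L²` norm. -/
noncomputable def cl2 (pt : Fin (N+1) → ℝ) (j : Fin N) (p : Polynomial ℝ) : ℝ :=
  Real.sqrt (cip pt j p p)

/-- Global `L²(Ω)` norm of a piecewise polynomial. -/
noncomputable def l2 (pt : Fin (N+1) → ℝ) (u : Fin N → Polynomial ℝ) : ℝ :=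
  Real.sqrt (ip pt u u)

/-- Average `avg(u) = (1/|Ω|) ∫_Ω u dx` (here `|Ω| = 1`). -/
noncomputable def avg (pt : Fin (N+1) → ℝ) (u : Fin N → Polynomial ℝ) : ℝ :=
  ∑ j : Fin N, ∫ x in (ptL pt j)..(ptR pt j), (u j).eval x

/-- `‖u - c‖_{L∞(Ω)}` for a piecewise polynomial `u` and a constant `c`. -/
noncomputable def linfSub (pt : Fin (N+1) → ℝ) (u : Fin N → Polynomial ℝ) (c : ℝ) : ℝ :=
  ⨆ j : Fin N, sSup ((fun x => |(u j).eval x - c|) '' Set.Icc (ptL pt j) (ptR pt j))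

/-- `m`-th derivative of a polynomial. -/
noncomputable def pderiv (m : ℕ) (p : Polynomial ℝ) : Polynomial ℝ :=
  (fun q : Polynomial ℝ => Polynomial.derivative q)^[m] p

/-- Jump `[∂_x^m u]_{j+1/2}` of the `m`-th derivative at the interface to the right of
cell `j`, with periodic identification of `x_{N+1/2}` with `x_{1/2}`. -/
noncomputable def jumpD [NeZero N] (pt : Fin (N+1) → ℝ) (u : Fin N → Polynomial ℝ)
    (m : ℕ) (j : Fin N) : ℝ :=
  (pderiv m (u (j+1))).eval (pt (Fin.castSucc (j+1))) - (pderiv m (u j)).eval (pt j.succ)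

/-- The scale-invariant damping coefficient `σ_j^m(u)` of the OEDG method. -/
noncomputable def sigma [NeZero N] (k : ℕ) (pt : Fin (N+1) → ℝ)
    (u : Fin N → Polynomial ℝ) (m : ℕ) (j : Fin N) : ℝ :=
  if ∀ i, u i = Polynomial.C (avg pt u) then 0
  else (2*(m:ℝ)+1) * (cellh pt j)^m / ((2*(k:ℝ)-1) * (Nat.factorial m)) *
    ((|jumpD pt u m (j-1)| + |jumpD pt u m j|) / (2 * linfSub pt u (avg pt u)))

/-- Damping rate `δ_j^m = β_j σ_j^m(u) / h_j`. -/
noncomputable def dampRate [NeZero N] (k : ℕ) (pt : Fin (N+1) → ℝ) (β : Fin N → ℝ)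
    (u : Fin N → Polynomial ℝ) (m : ℕ) (j : Fin N) : ℝ :=
  β j * sigma k pt u m j / cellh pt j

/-- `Pc j d` is the cellwise `L²(I_j)`-orthogonal projection onto `ℙ^d(I_j)`.
(The family `Pc` realizes the global projections `P^d` onto `V^d`.) -/
def IsCellProj (pt : Fin (N+1) → ℝ)
    (Pc : Fin N → ℕ → Polynomial ℝ → Polynomial ℝ) : Prop :=
  ∀ (j : Fin N) (dd : ℕ) (p : Polynomial ℝ), (Pc j dd p).natDegree ≤ dd ∧
    ∀ q : Polynomial ℝ, q.natDegree ≤ dd → cip pt j (p - Pc j dd p) q = 0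

/-- `w` solves the damping initial value problem with initial data `u`:
`d/dt̂ ∫_{I_j} u_σ v dx + ∑_{m=0}^k (β_j σ_j^m(u)/h_j) ∫_{I_j} (u_σ - P^{m-1} u_σ) v dx = 0`
for every `v ∈ ℙ^k(I_j)` and every `j`, with `u_σ(·,0) = u`.  (Note `m - 1` is
truncated ℕ-subtraction, which realizes the convention `P^{-1} = P^0`.) -/
def IsDampingSol [NeZero N] (k : ℕ) (pt : Fin (N+1) → ℝ) (β : Fin N → ℝ)
    (Pc : Fin N → ℕ → Polynomial ℝ → Polynomial ℝ)
    (u : Fin N → Polynomial ℝ) (w : ℝ → Fin N → Polynomial ℝ) : Prop :=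
  w 0 = u ∧ (∀ t j, (w t j).natDegree ≤ k) ∧
  ∀ (t : ℝ) (j : Fin N) (v : Polynomial ℝ), v.natDegree ≤ k →
    HasDerivAt (fun s => cip pt j (w s j) v)
      (-(∑ m ∈ Finset.range (k+1),
        dampRate k pt β u m j * cip pt j (w t j - Pc j (m-1) (w t j)) v)) t

/-- `Fτ` is the OE (oscillation-eliminating) operator: for every `u ∈ V^k` the damping
initial value problem has a solution `w` and `Fτ u = w τ`. -/
def IsOEOp [NeZero N] (k : ℕ) (pt : Fin (N+1) → ℝ) (β : Fin N → ℝ)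
    (Pc : Fin N → ℕ → Polynomial ℝ → Polynomial ℝ) (τ : ℝ)
    (Fτ : (Fin N → Polynomial ℝ) → (Fin N → Polynomial ℝ)) : Prop :=
  ∀ u, MemVk k u → ∃ w, IsDampingSol k pt β Pc u w ∧ Fτ u = w τ

/-- Right-hand side of the weak form of the upwind DG operator for `u_t + β u_x = 0`:
`β ∫_{I_j} w v_x dx - β w(x_{j+1/2}^-) v(x_{j+1/2}^-) + β w(x_{j-1/2}^-) v(x_{j-1/2}^+)`. -/
noncomputable def dgRHS [NeZero N] (pt : Fin (N+1) → ℝ) (β : ℝ)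
    (w : Fin N → Polynomial ℝ) (j : Fin N) (v : Polynomial ℝ) : ℝ :=
  β * (∫ x in (ptL pt j)..(ptR pt j), (w j).eval x * (Polynomial.derivative v).eval x)
  - β * (w j).eval (ptR pt j) * v.eval (ptR pt j)
  + β * (w (j-1)).eval (pt (j-1).succ) * v.eval (ptL pt j)

/-- `L` is the upwind DG spatial operator on `V^k`. -/
def IsDGOp [NeZero N] (k : ℕ) (pt : Fin (N+1) → ℝ) (β : ℝ)
    (L : (Fin N → Polynomial ℝ) → (Fin N → Polynomial ℝ)) : Prop :=
  ∀ w, MemVk k w → MemVk k (L w) ∧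
    ∀ (j : Fin N) (v : Polynomial ℝ), v.natDegree ≤ k →
      cip pt j (L w j) v = dgRHS pt β w j v

/-- The upwind DG bilinear form
`H(w,v) = β ∑_j ∫_{I_j} w v_x dx + β ∑_j w(x_{j+1/2}^-) [v]_{j+1/2}`. -/
noncomputable def Hform [NeZero N] (pt : Fin (N+1) → ℝ) (β : ℝ)
    (w v : Fin N → Polynomial ℝ) : ℝ :=
  β * ∑ j : Fin N, (∫ x in (ptL pt j)..(ptR pt j),
      (w j).eval x * (Polynomial.derivative (v j)).eval x)
  + β * ∑ j : Fin N, (w j).eval (ptR pt j) * jumpD pt v 0 j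

/-- The upwind DG bilinear form with piecewise-smooth first argument. -/
noncomputable def HformF [NeZero N] (pt : Fin (N+1) → ℝ) (β : ℝ)
    (w : Fin N → ℝ → ℝ) (v : Fin N → Polynomial ℝ) : ℝ :=
  β * ∑ j : Fin N, (∫ x in (ptL pt j)..(ptR pt j),
      w j x * (Polynomial.derivative (v j)).eval x)
  + β * ∑ j : Fin N, w j (ptR pt j) * jumpD pt v 0 j

/-- `L²(Ω)` pairing of a piecewise-smooth function with a piecewise polynomial. -/
noncomputable def ipF (pt : Fin (N+1) → ℝ) (w : Fin N → ℝ → ℝ)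
    (v : Fin N → Polynomial ℝ) : ℝ :=
  ∑ j : Fin N, ∫ x in (ptL pt j)..(ptR pt j), w j x * (v j).eval x

/-- One Runge–Kutta stage: `∑_{0≤m≤ℓ} (c_{ℓm} u_σ^{n,m} + τ d_{ℓm} L(u_σ^{n,m}))`. -/
noncomputable def rkStage [NeZero N] (c d : ℕ → ℕ → ℝ) (τ : ℝ)
    (L : (Fin N → Polynomial ℝ) → (Fin N → Polynomial ℝ))
    (uσ : ℕ → Fin N → Polynomial ℝ) (ℓ : ℕ) : Fin N → Polynomial ℝ :=
  fun j => ∑ m ∈ Finset.range (ℓ+1),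
    (Polynomial.C (c ℓ m) * uσ m j + Polynomial.C (τ * d ℓ m) * L (uσ m) j)

/-- One full OEDG time step from `u_σ^n = un`: the stages `u_h^{n,ℓ+1}` and
`u_σ^{n,ℓ+1} = F_τ u_h^{n,ℓ+1}`, `0 ≤ ℓ ≤ s-1`. -/
def IsOEDGStep [NeZero N] (s : ℕ) (c d : ℕ → ℕ → ℝ) (τ : ℝ)
    (L Fτ : (Fin N → Polynomial ℝ) → (Fin N → Polynomial ℝ))
    (un : Fin N → Polynomial ℝ) (uh uσ : ℕ → Fin N → Polynomial ℝ) : Prop :=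
  uσ 0 = un ∧ ∀ ℓ < s, uh (ℓ+1) = rkStage c d τ L uσ ℓ ∧ uσ (ℓ+1) = Fτ (uh (ℓ+1))

/-- The full OEDG evolution: `uσ n ℓ = u_σ^{n,ℓ}` and `uh n ℓ = u_h^{n,ℓ}`, starting from
`u_σ^0 = u0`, with `u_σ^{n+1} = u_σ^{n,s}`. -/
def IsOEDGEvol [NeZero N] (s : ℕ) (c d : ℕ → ℕ → ℝ) (τ : ℝ)
    (L Fτ : (Fin N → Polynomial ℝ) → (Fin N → Polynomial ℝ))
    (u0 : Fin N → Polynomial ℝ) (uh uσ : ℕ → ℕ → Fin N → Polynomial ℝ) : Prop :=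
  uσ 0 0 = u0 ∧ ∀ n, uσ (n+1) 0 = uσ n s ∧
    ∀ ℓ < s, uh n (ℓ+1) = rkStage c d τ L (uσ n) ℓ ∧ uσ n (ℓ+1) = Fτ (uh n (ℓ+1))

/-- `p` is the Gauss–Radau projection of `w` on `[a,b]` into `ℙ^k`:
`∫_a^b (w - p) q dx = 0` for all `q ∈ ℙ^{k-1}` and `p(b) = w(b)`. -/
def IsGRProj (k : ℕ) (a b : ℝ) (w : ℝ → ℝ) (p : Polynomial ℝ) : Prop :=
  p.natDegree ≤ k ∧
  (∀ q : Polynomial ℝ, q.natDegree < k →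
    (∫ x in a..b, (w x - p.eval x) * q.eval x) = 0) ∧
  p.eval b = w b

/-- `u = u(x,t)` is a smooth `1`-periodic exact solution of `u_t + β u_x = 0`. -/
def IsSmoothSolution (β : ℝ) (u : ℝ → ℝ → ℝ) : Prop :=
  ContDiff ℝ (⊤ : ℕ∞) (fun p : ℝ × ℝ => u p.1 p.2) ∧
  (∀ x t, u (x+1) t = u x t) ∧
  (∀ x t, deriv (fun s => u x s) t + β * deriv (fun y => u y t) x = 0)

/-- Auxiliary table for the reference functions `U^{n,ℓ}`. -/
noncomputable def UrefUpTo (u : ℝ → ℝ → ℝ) (c d : ℕ → ℕ → ℝ) (β τ : ℝ) (n : ℕ) :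
    ℕ → ℕ → ℝ → ℝ
  | 0 => fun _ => fun x => u x ((n:ℝ) * τ)
  | (ℓ+1) => fun i =>
      if i ≤ ℓ then UrefUpTo u c d β τ n ℓ i
      else fun x => ∑ m ∈ Finset.range (ℓ+1),
        (c ℓ m * UrefUpTo u c d β τ n ℓ m x
          - τ * d ℓ m * β * deriv (UrefUpTo u c d β τ n ℓ m) x)

/-- Reference function `U^{n,ℓ}` (for `0 ≤ ℓ ≤ s-1`): `U^{n,0} = u(·, t^n)` and
`U^{n,ℓ+1} = ∑_{0≤m≤ℓ} (c_{ℓm} U^{n,m} - τ d_{ℓm} β ∂_x U^{n,m})`. -/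
noncomputable def Uref (u : ℝ → ℝ → ℝ) (c d : ℕ → ℕ → ℝ) (β τ : ℝ) (n ℓ : ℕ) : ℝ → ℝ :=
  UrefUpTo u c d β τ n ℓ ℓ

/-- Reference function `U^{n,ℓ}` including the final stage `U^{n,s} := u(·, t^{n+1})`. -/
noncomputable def UrefS (u : ℝ → ℝ → ℝ) (c d : ℕ → ℕ → ℝ) (β τ : ℝ) (s n ℓ : ℕ) : ℝ → ℝ :=
  if ℓ = s then fun x => u x (((n:ℝ)+1) * τ) else Uref u c d β τ n ℓ

/-- The Runge–Kutta residual `ρ^{n,s-1}`, defined so that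
`U^{n,s} = ∑_{0≤m≤s-1} (c_{s-1,m} U^{n,m} - τ d_{s-1,m} β ∂_x U^{n,m}) + τ ρ^{n,s-1}`. -/
noncomputable def rkRes (u : ℝ → ℝ → ℝ) (c d : ℕ → ℕ → ℝ) (β τ : ℝ) (s n : ℕ) : ℝ → ℝ :=
  fun x => (u x (((n:ℝ)+1) * τ) - ∑ m ∈ Finset.range s,
    (c (s-1) m * Uref u c d β τ n m x
      - τ * d (s-1) m * β * deriv (Uref u c d β τ n m) x)) / τ

/-- `L²(0,1)` norm of a function. -/
noncomputable def fl2 (f : ℝ → ℝ) : ℝ := Real.sqrt (∫ x in (0:ℝ)..1, (f x)^2)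

/-- `L²(Ω)` distance between a piecewise polynomial and a function. -/
noncomputable def errL2 (pt : Fin (N+1) → ℝ) (w : Fin N → Polynomial ℝ) (f : ℝ → ℝ) : ℝ :=
  Real.sqrt (∑ j : Fin N, ∫ x in (ptL pt j)..(ptR pt j), ((w j).eval x - f x)^2)

/-! ### Polynomial inequalities -/

/-- Coercivity of the weighted `L²(0,1)` form with weight `1 - x` on polynomials of degree at
most `k`: it controls the sum of the absolute values of the coefficients. -/
lemma exists_sq_sum_abs_coeff_le (k : ℕ) : ∃ K : ℝ, 0 < K ∧ ∀ p : ℝ[X], p.natDegree ≤ k →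
    (∑ i ∈ range (k+1), |p.coeff i|)^2 ≤ K * ∫ x in (0:ℝ)..1, (1 - x) * p.eval x ^ 2 := by
  let F : (Fin (k+1) → ℝ) → ℝ := fun a => (∑ i, |a i|)^2
  let Q : (Fin (k+1) → ℝ) → ℝ := fun a =>
    ∫ x in (0:ℝ)..1, (1 - x) * (∑ i, a i * x ^ (i:ℕ)) ^ 2
  have hF : Continuous F := by fun_prop
  have hQ : Continuous Q := by
    apply intervalIntegral.continuous_parametric_intervalIntegral_of_continuous'
    unfold Function.uncurry
    fun_prop
  have hQpos : ∀ a, a ≠ 0 → 0 < Q a := by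
    intro a ha
    have hp : (∑ i : Fin (k+1), C (a i) * X ^ (i:ℕ) : ℝ[X]) ≠ 0 := by
      intro h0
      apply ha
      funext i
      have := congrArg (fun q : ℝ[X] => q.coeff (i:ℕ)) h0
      simpa [finsetSum_coeff, coeff_C_mul, coeff_X_pow, Fin.val_inj] using this
    refine intervalIntegral.integral_pos one_pos (by fun_prop) ?_ ?_
    · intro x hx
      have := hx.2
      have : 0 ≤ 1 - x := by linarith
      positivity
    · by_contra! hcon
      apply hp
      apply eq_zero_of_infinite_isRoot
      apply (Set.Ico_infinite (one_pos (α := ℝ))).mono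
      intro x hx
      have h1 := hcon x ⟨hx.1, hx.2.le⟩
      have h2 : 0 < 1 - x := by linarith [hx.2]
      have h3 : (∑ i, a i * x ^ (i:ℕ)) ^ 2 ≤ 0 := by
        by_contra! h
        exact absurd h1 (not_le.2 (mul_pos h2 h))
      have h4 := pow_eq_zero_iff (two_ne_zero) |>.1 (le_antisymm h3 (sq_nonneg _))
      simpa [IsRoot, eval_finsetSum] using h4
  have hcont : ContinuousOn (fun a => F a / Q a) (Metric.sphere (0 : Fin (k+1) → ℝ) 1) := by
    apply hF.continuousOn.div hQ.continuousOn
    intro a ha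
    exact (hQpos a (ne_zero_of_mem_unit_sphere ⟨a, ha⟩)).ne'
  obtain ⟨K, hK⟩ := (isCompact_sphere (0 : Fin (k+1) → ℝ) 1).bddAbove_image hcont
  have key : ∀ a, F a ≤ max K 1 * Q a := by
    intro a
    by_cases ha : a = 0
    · subst ha
      simp [F, Q]
    have hn : 0 < ‖a‖ := norm_pos_iff.2 ha
    have hFs : ∀ (t : ℝ) a, F (t • a) = t^2 * F a := by
      intro t a
      simp only [F, Pi.smul_apply, smul_eq_mul, abs_mul, ← Finset.mul_sum, mul_pow, sq_abs]
    have hQs : ∀ (t : ℝ) a, Q (t • a) = t^2 * Q a := by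
      intro t a
      simp only [Q, Pi.smul_apply, smul_eq_mul, mul_assoc, ← Finset.mul_sum, mul_pow,
        ← intervalIntegral.integral_const_mul]
      congr 1
      funext x
      ring
    set v := ‖a‖⁻¹ • a with hv
    have hva : a = ‖a‖ • v := by rw [hv, smul_smul, mul_inv_cancel₀ hn.ne', one_smul]
    have hvs : v ∈ Metric.sphere (0 : Fin (k+1) → ℝ) 1 := by
      simp [hv, norm_smul, hn.ne']
    have hv0 : v ≠ 0 := ne_zero_of_mem_unit_sphere ⟨v, hvs⟩
    have h1 := hK ⟨v, hvs, rfl⟩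
    rw [div_le_iff₀ (hQpos v hv0)] at h1
    rw [hva, hFs, hQs]
    have h2 : K * Q v ≤ max K 1 * Q v :=
      mul_le_mul_of_nonneg_right (le_max_left _ _) (hQpos v hv0).le
    nlinarith [sq_nonneg ‖a‖]
  refine ⟨max K 1, by positivity, fun p hp => ?_⟩
  have := key (fun i => p.coeff i)
  simp only [F, Q] at this
  rw [Finset.sum_range]
  refine this.trans_eq ?_
  congr 2
  funext x
  rw [eval_eq_sum_range' (Nat.lt_succ_of_le hp), Finset.sum_range]

lemma abs_eval_le_sum_abs_coeff {k : ℕ} {p : ℝ[X]} (hp : p.natDegree ≤ k) {x : ℝ}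
    (hx : x ∈ Set.Icc (0:ℝ) 1) : |p.eval x| ≤ ∑ i ∈ range (k+1), |p.coeff i| := by
  rw [eval_eq_sum_range' (Nat.lt_succ_of_le hp)]
  refine (abs_sum_le_sum_abs _ _).trans (Finset.sum_le_sum fun i _ => ?_)
  rw [abs_mul, abs_of_nonneg (pow_nonneg hx.1 i)]
  exact mul_le_of_le_one_right (abs_nonneg _) (pow_le_one₀ hx.1 hx.2)

lemma abs_eval_derivative_le_sum_abs_coeff {k : ℕ} {p : ℝ[X]} (hp : p.natDegree ≤ k) {x : ℝ}
    (hx : x ∈ Set.Icc (0:ℝ) 1) :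
    |(derivative p).eval x| ≤ (k+1) * ∑ i ∈ range (k+1), |p.coeff i| := by
  have hd : (derivative p).natDegree ≤ k := (natDegree_derivative_le p).trans (by omega)
  refine (abs_eval_le_sum_abs_coeff hd hx).trans ?_
  have h1 : ∀ i ∈ range (k+1), |(derivative p).coeff i| ≤ (k+1) * |p.coeff (i+1)| := by
    intro i hi
    have hi' : (i:ℝ) + 1 ≤ k + 1 := by
      have := Nat.lt_succ_iff.1 (mem_range.1 hi)
      gcongr
    rw [coeff_derivative, abs_mul, abs_of_nonneg (by positivity : (0:ℝ) ≤ i + 1), mul_comm]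
    gcongr
  refine (Finset.sum_le_sum h1).trans ?_
  rw [← Finset.mul_sum]
  refine mul_le_mul_of_nonneg_left ?_ (by positivity)
  have h2 := Finset.sum_range_succ' (fun i => |p.coeff i|) (k+1)
  rw [Finset.sum_range_succ, coeff_eq_zero_of_natDegree_lt (Nat.lt_succ_of_le hp)] at h2
  simp only [abs_zero, add_zero] at h2
  rw [h2]
  exact le_add_of_nonneg_right (abs_nonneg _)

lemma integral_eq_mul_integral_unit (f : ℝ → ℝ) {a b : ℝ} (hab : a < b) :
    ∫ x in a..b, f x = (b - a) * ∫ x in (0:ℝ)..1, f (a + (b - a) * x) := by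
  have h : b - a ≠ 0 := by linarith
  rw [intervalIntegral.integral_comp_add_mul f h]
  simp [h]

/-- Inverse and trace inequalities for polynomials of degree at most `k` on an interval, and the
comparison of the `L²` norm with the one weighted by the distance to the right endpoint. -/
lemma exists_inverse_const (k : ℕ) : ∃ K : ℝ, 0 < K ∧ ∀ p : ℝ[X], p.natDegree ≤ k →
    ∀ a b : ℝ, a < b →
      (∀ x ∈ Set.Icc a b, (b - a) * p.eval x ^ 2 ≤ K * ∫ x in a..b, p.eval x ^ 2) ∧
      (b - a)^2 * (∫ x in a..b, (derivative p).eval x ^ 2) ≤ K * ∫ x in a..b, p.eval x ^ 2 ∧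
      (b - a) * (∫ x in a..b, p.eval x ^ 2) ≤ K * ∫ x in a..b, (b - x) * p.eval x ^ 2 := by
  obtain ⟨K, hK, hcoer⟩ := exists_sq_sum_abs_coeff_le k
  refine ⟨(k+1)^2 * K, by positivity, fun p hp a b hab => ?_⟩
  have hh : 0 < b - a := sub_pos.2 hab
  have hk1 : (1:ℝ) ≤ (k+1)^2 := by
    have : (0:ℝ) ≤ k := k.cast_nonneg
    nlinarith
  set q : ℝ[X] := p.comp (C a + C (b - a) * X) with hq
  have hqdeg : q.natDegree ≤ k := by
    refine natDegree_comp_le.trans ?_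
    have : (C a + C (b - a) * X : ℝ[X]).natDegree ≤ 1 := by
      rw [add_comm]
      exact natDegree_linear_le
    nlinarith
  have hqe : ∀ x, q.eval x = p.eval (a + (b - a) * x) := by
    intro x
    simp [hq]
  have hqd : ∀ x, (derivative q).eval x = (b - a) * (derivative p).eval (a + (b - a) * x) := by
    intro x
    simp [hq, derivative_comp]
  set A : ℝ := ∑ i ∈ range (k+1), |q.coeff i| with hA
  have hA0 : 0 ≤ A := Finset.sum_nonneg fun i _ => abs_nonneg _
  set I : ℝ := ∫ x in (0:ℝ)..1, q.eval x ^ 2 with hI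
  set J : ℝ := ∫ x in (0:ℝ)..1, (1 - x) * q.eval x ^ 2 with hJ
  have hAJ : A^2 ≤ K * J := hcoer q hqdeg
  have hJI : J ≤ I := by
    apply intervalIntegral.integral_mono_on zero_le_one
      (Continuous.intervalIntegrable (by fun_prop) _ _)
      (Continuous.intervalIntegrable (by fun_prop) _ _)
    intro x hx
    nlinarith [sq_nonneg (q.eval x), hx.1]
  have hAI : A^2 ≤ K * I := hAJ.trans (by gcongr)
  have hJ0 : 0 ≤ J := by
    by_contra! h
    nlinarith [sq_nonneg A]
  have eI : ∫ x in a..b, p.eval x ^ 2 = (b - a) * I := by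
    rw [integral_eq_mul_integral_unit _ hab, hI]
    simp only [hqe]
  have eJ : ∫ x in a..b, (b - x) * p.eval x ^ 2 = (b - a) * ((b - a) * J) := by
    rw [integral_eq_mul_integral_unit _ hab, hJ]
    congr 1
    rw [← intervalIntegral.integral_const_mul]
    simp only [hqe]
    congr 1
    funext x
    ring
  have eD : (b - a)^2 * ∫ x in a..b, (derivative p).eval x ^ 2
      = (b - a) * ∫ x in (0:ℝ)..1, (derivative q).eval x ^ 2 := by
    rw [integral_eq_mul_integral_unit _ hab, mul_left_comm,
      ← intervalIntegral.integral_const_mul ((b - a)^2)]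
    simp only [hqd, mul_pow]
  have hIA : I ≤ A^2 := by
    have : I ≤ ∫ x in (0:ℝ)..1, A^2 := by
      apply intervalIntegral.integral_mono_on zero_le_one
        (Continuous.intervalIntegrable (by fun_prop) _ _)
        (Continuous.intervalIntegrable (by fun_prop) _ _)
      intro x hx
      exact sq_le_sq.2 ((abs_eval_le_sum_abs_coeff hqdeg hx).trans (le_abs_self _))
    simpa using this
  refine ⟨?_, ?_, ?_⟩
  · intro x hx
    have hx' : (x - a) / (b - a) ∈ Set.Icc (0:ℝ) 1 :=
      ⟨div_nonneg (by linarith [hx.1]) hh.le, (div_le_one hh).2 (by linarith [hx.2])⟩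
    have h1 := abs_eval_le_sum_abs_coeff hqdeg hx'
    rw [hqe, mul_div_cancel₀ _ hh.ne', add_sub_cancel] at h1
    have h2 : p.eval x ^ 2 ≤ A^2 := sq_le_sq.2 (h1.trans (le_abs_self _))
    rw [eI]
    have h3 : A^2 ≤ (k+1)^2 * K * I := by nlinarith [sq_nonneg A]
    nlinarith
  · have hD : ∫ x in (0:ℝ)..1, (derivative q).eval x ^ 2 ≤ ∫ x in (0:ℝ)..1, ((k+1) * A)^2 := by
      apply intervalIntegral.integral_mono_on zero_le_one
        (Continuous.intervalIntegrable (by fun_prop) _ _)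
        (Continuous.intervalIntegrable (by fun_prop) _ _)
      intro x hx
      exact sq_le_sq.2 ((abs_eval_derivative_le_sum_abs_coeff hqdeg hx).trans (le_abs_self _))
    rw [intervalIntegral.integral_const, sub_zero, one_smul, mul_pow] at hD
    rw [eD, eI]
    have h3 : (k+1:ℝ)^2 * A^2 ≤ (k+1)^2 * (K * I) := by gcongr
    nlinarith
  · rw [eI, eJ]
    have h3 : I ≤ (k+1)^2 * K * J := by nlinarith [mul_nonneg hK.le hJ0]
    calc (b - a) * ((b - a) * I) ≤ (b - a) * ((b - a) * ((k+1)^2 * K * J)) := by gcongr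
      _ = _ := by ring

/-! ### Cauchy–Schwarz and the Gauss–Radau projection -/

lemma sq_le_mul_of_forall_quadratic_nonneg {A B D : ℝ}
    (h : ∀ t : ℝ, 0 ≤ A + 2 * t * B + t^2 * D) : B^2 ≤ A * D := by
  have := discrim_le_zero (a := D) (b := 2 * B) (c := A) (fun x => by
    have := h x
    nlinarith)
  unfold discrim at this
  nlinarith

lemma sq_integral_mul_le {f g : ℝ → ℝ} (hf : Continuous f) (hg : Continuous g) {a b : ℝ}
    (hab : a ≤ b) :
    (∫ x in a..b, f x * g x)^2 ≤ (∫ x in a..b, f x ^ 2) * ∫ x in a..b, g x ^ 2 := by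
  apply sq_le_mul_of_forall_quadratic_nonneg
  intro t
  have h1 : 0 ≤ ∫ x in a..b, (f x + t * g x)^2 :=
    intervalIntegral.integral_nonneg hab fun x _ => sq_nonneg _
  have h2 : ∫ x in a..b, (f x + t * g x)^2
      = ∫ x in a..b, (f x ^ 2 + 2 * t * (f x * g x) + t^2 * g x ^ 2) := by
    congr 1
    funext x
    ring
  rw [h2, intervalIntegral.integral_add (Continuous.intervalIntegrable (by fun_prop) _ _)
      (Continuous.intervalIntegrable (by fun_prop) _ _),
    intervalIntegral.integral_add (Continuous.intervalIntegrable (by fun_prop) _ _)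
      (Continuous.intervalIntegrable (by fun_prop) _ _),
    intervalIntegral.integral_const_mul, intervalIntegral.integral_const_mul] at h1
  exact h1

/-- A polynomial with `∫ p² = 0` vanishes. -/
lemma eq_zero_of_integral_sq_le_zero {p : ℝ[X]} {a b : ℝ} (hab : a < b)
    (h : ∫ x in a..b, p.eval x ^ 2 ≤ 0) : p = 0 := by
  by_contra hp
  refine absurd h (not_le.2 ?_)
  refine intervalIntegral.integral_pos hab (by fun_prop) (fun x _ => sq_nonneg _) ?_
  by_contra! hcon
  refine hp (eq_zero_of_infinite_isRoot p ((Set.Icc_infinite hab).mono fun x hx => ?_))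
  exact pow_eq_zero_iff two_ne_zero |>.1 (le_antisymm (hcon x hx) (sq_nonneg _))

/-- `L²` stability of the Gauss–Radau projection for data vanishing at the right endpoint. -/
lemma exists_radau_stability_const (k : ℕ) : ∃ K : ℝ, 0 < K ∧ ∀ (a b : ℝ), a < b →
    ∀ (R : ℝ → ℝ), Continuous R → ∀ q : ℝ[X], q.natDegree ≤ k → q.eval b = 0 →
      (∀ v : ℝ[X], v.natDegree < k → ∫ x in a..b, (R x - q.eval x) * v.eval x = 0) →
      ∫ x in a..b, q.eval x ^ 2 ≤ K * ∫ x in a..b, R x ^ 2 := by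
  obtain ⟨K, hK, hinv⟩ := exists_inverse_const k
  refine ⟨K, hK, fun a b hab R hR q hq hqb horth => ?_⟩
  have hh : 0 < b - a := sub_pos.2 hab
  have hR0 : 0 ≤ ∫ x in a..b, R x ^ 2 :=
    intervalIntegral.integral_nonneg hab.le fun x _ => sq_nonneg _
  by_cases hq0 : q = 0
  · subst hq0
    simpa using mul_nonneg hK.le hR0
  obtain ⟨g, hg⟩ := dvd_iff_isRoot.2 hqb
  have hg0 : g ≠ 0 := by
    rintro rfl
    simp [hg] at hq0
  have hdeg : q.natDegree = 1 + g.natDegree := by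
    rw [hg, natDegree_mul (X_sub_C_ne_zero b) hg0, natDegree_X_sub_C]
  have hqe : ∀ x, q.eval x = (x - b) * g.eval x := by
    intro x
    simp [hg]
  set G : ℝ := ∫ x in a..b, g.eval x ^ 2 with hG
  set W : ℝ := ∫ x in a..b, (b - x) * g.eval x ^ 2 with hW
  set S : ℝ := ∫ x in a..b, R x ^ 2 with hS
  have hGW : (b - a) * G ≤ K * W := (hinv g (by omega) a b hab).2.2
  have hG0 : 0 ≤ G := intervalIntegral.integral_nonneg hab.le fun x _ => sq_nonneg _
  have hW0 : 0 ≤ W := by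
    refine intervalIntegral.integral_nonneg hab.le fun x hx => ?_
    exact mul_nonneg (by linarith [hx.2]) (sq_nonneg _)
  have hWR : W = -∫ x in a..b, R x * g.eval x := by
    have h := horth g (by omega)
    have h2 : ∫ x in a..b, (R x - q.eval x) * g.eval x
        = ∫ x in a..b, (R x * g.eval x + (b - x) * g.eval x ^ 2) := by
      congr 1
      funext x
      rw [hqe]
      ring
    rw [h2, intervalIntegral.integral_add (Continuous.intervalIntegrable (by fun_prop) _ _)
      (Continuous.intervalIntegrable (by fun_prop) _ _)] at h
    linarith
  have hcs : W^2 ≤ S * G := by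
    rw [hWR, neg_sq]
    exact sq_integral_mul_le hR (by fun_prop) hab.le
  have hqW : ∫ x in a..b, q.eval x ^ 2 ≤ (b - a) * W := by
    rw [hW, ← intervalIntegral.integral_const_mul]
    apply intervalIntegral.integral_mono_on hab.le
      (Continuous.intervalIntegrable (by fun_prop) _ _)
      (Continuous.intervalIntegrable (by fun_prop) _ _)
    intro x hx
    rw [hqe, mul_pow]
    have h1 : 0 ≤ (b - x) * g.eval x ^ 2 := mul_nonneg (by linarith [hx.2]) (sq_nonneg _)
    nlinarith [hx.1]
  refine hqW.trans ?_
  by_cases hW1 : W = 0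
  · rw [hW1, mul_zero]
    positivity
  have hWpos : 0 < W := lt_of_le_of_ne hW0 (Ne.symm hW1)
  have h3 : ((b - a) * W) * W ≤ (K * S) * W := by
    calc ((b - a) * W) * W = (b - a) * W^2 := by ring
      _ ≤ (b - a) * (S * G) := by gcongr
      _ = S * ((b - a) * G) := by ring
      _ ≤ S * (K * W) := by gcongr
      _ = (K * S) * W := by ring
  exact le_of_mul_le_mul_right h3 hWpos

lemma IsGRProj.sub_orthogonal {k : ℕ} {a b : ℝ} {w : ℝ → ℝ} {p q : ℝ[X]}
    (hp : IsGRProj k a b w p) {v : ℝ[X]} (hv : v.natDegree < k) :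
    ∫ x in a..b, ((w x - q.eval x) - (p - q).eval x) * v.eval x = 0 := by
  rw [← hp.2.1 v hv]
  congr 1
  funext x
  rw [eval_sub]
  ring

lemma IsGRProj.unique {k : ℕ} {a b : ℝ} (hab : a < b) {w : ℝ → ℝ} (hw : Continuous w)
    {p q : ℝ[X]} (hp : IsGRProj k a b w p) (hq : IsGRProj k a b w q) : p = q := by
  obtain ⟨K, -, hstab⟩ := exists_radau_stability_const k
  have h := hstab a b hab (fun _ => 0) continuous_const (p - q)
    ((natDegree_sub_le _ _).trans (max_le hp.1 hq.1))
    (by rw [eval_sub, hp.2.2, hq.2.2, sub_self])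
    (fun v hv => by
      have h1 := hp.2.1 v hv
      have h2 := hq.2.1 v hv
      have h3 : ∫ x in a..b, (0 - (p - q).eval x) * v.eval x
          = ∫ x in a..b, ((w x - p.eval x) * v.eval x - (w x - q.eval x) * v.eval x) := by
        congr 1
        funext x
        rw [eval_sub]
        ring
      rw [h3, intervalIntegral.integral_sub (Continuous.intervalIntegrable (by fun_prop) _ _)
        (Continuous.intervalIntegrable (by fun_prop) _ _), h1, h2, sub_zero])
  have h0 : ∫ x in a..b, (p - q).eval x ^ 2 ≤ 0 := by simpa using h
  exact sub_eq_zero.1 (eq_zero_of_integral_sq_le_zero hab h0)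

lemma IsGRProj.add {k : ℕ} {a b : ℝ} {w₁ w₂ : ℝ → ℝ} (h₁ : Continuous w₁) (h₂ : Continuous w₂)
    {p₁ p₂ : ℝ[X]} (hp₁ : IsGRProj k a b w₁ p₁) (hp₂ : IsGRProj k a b w₂ p₂) :
    IsGRProj k a b (fun x => w₁ x + w₂ x) (p₁ + p₂) := by
  refine ⟨(natDegree_add_le _ _).trans (max_le hp₁.1 hp₂.1), fun q hq => ?_, ?_⟩
  · have h3 : ∫ x in a..b, (w₁ x + w₂ x - (p₁ + p₂).eval x) * q.eval x
        = ∫ x in a..b, ((w₁ x - p₁.eval x) * q.eval x + (w₂ x - p₂.eval x) * q.eval x) := by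
      congr 1
      funext x
      rw [eval_add]
      ring
    rw [h3, intervalIntegral.integral_add (Continuous.intervalIntegrable (by fun_prop) _ _)
      (Continuous.intervalIntegrable (by fun_prop) _ _), hp₁.2.1 q hq, hp₂.2.1 q hq, add_zero]
  · rw [eval_add, hp₁.2.2, hp₂.2.2]

lemma IsGRProj.const_mul {k : ℕ} {a b : ℝ} {w : ℝ → ℝ} {p : ℝ[X]} (hp : IsGRProj k a b w p)
    (t : ℝ) : IsGRProj k a b (fun x => t * w x) (C t * p) := by
  refine ⟨(natDegree_C_mul_le _ _).trans hp.1, fun q hq => ?_, ?_⟩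
  · have h3 : ∫ x in a..b, (t * w x - (C t * p).eval x) * q.eval x
        = ∫ x in a..b, t * ((w x - p.eval x) * q.eval x) := by
      congr 1
      funext x
      rw [eval_mul, eval_C]
      ring
    rw [h3, intervalIntegral.integral_const_mul, hp.2.1 q hq, mul_zero]
  · rw [eval_mul, eval_C, hp.2.2]

lemma IsGRProj.zero (k : ℕ) (a b : ℝ) : IsGRProj k a b (fun _ => 0) 0 :=
  ⟨by simp, fun q _ => by simp, by simp⟩

lemma IsGRProj.sum {ι : Type*} {k : ℕ} {a b : ℝ} {s : Finset ι} {w : ι → ℝ → ℝ} {p : ι → ℝ[X]}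
    (hw : ∀ i ∈ s, Continuous (w i)) (hp : ∀ i ∈ s, IsGRProj k a b (w i) (p i)) :
    IsGRProj k a b (fun x => ∑ i ∈ s, w i x) (∑ i ∈ s, p i) := by
  classical
  induction s using Finset.induction_on with
  | empty => simpa using IsGRProj.zero k a b
  | insert i s his ih =>
    simp only [Finset.sum_insert his]
    exact IsGRProj.add (hw i (mem_insert_self i s))
      (continuous_finsetSum s fun j hj => hw j (mem_insert_of_mem hj))
      (hp i (mem_insert_self i s))
      (ih (fun j hj => hw j (mem_insert_of_mem hj)) fun j hj => hp j (mem_insert_of_mem hj))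

lemma exists_derivative_eq_natDegree_le (p : ℝ[X]) :
    ∃ q : ℝ[X], derivative q = p ∧ q.natDegree ≤ p.natDegree + 1 := by
  refine ⟨∑ i ∈ range (p.natDegree + 1), C (p.coeff i / (i+1)) * X ^ (i+1), ?_, ?_⟩
  · rw [derivative_sum]
    conv_rhs => rw [p.as_sum_range_C_mul_X_pow]
    refine Finset.sum_congr rfl fun i _ => ?_
    have hi : (i:ℝ) + 1 ≠ 0 := by positivity
    rw [derivative_C_mul_X_pow]
    push_cast
    rw [div_mul_cancel₀ _ hi]
  · refine natDegree_sum_le_of_forall_le _ _ fun i hi => ?_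
    refine (natDegree_C_mul_X_pow_le _ _).trans ?_
    have := mem_range.1 hi
    omega

/-- Polynomial approximation of order `k + 1` that is exact at the right endpoint. -/
lemma exists_polynomial_approx (k : ℕ) : ∀ {a b M : ℝ}, a ≤ b → ∀ {W : ℝ → ℝ},
    ContDiff ℝ (⊤ : ℕ∞) W → (∀ x, |iteratedDeriv (k+1) W x| ≤ M) →
    ∃ T : ℝ[X], T.natDegree ≤ k ∧ T.eval b = W b ∧
      ∀ x ∈ Set.Icc a b, |W x - T.eval x| ≤ M * (b - a)^(k+1) := by
  have step : ∀ {a b D : ℝ} {f : ℝ → ℝ}, a ≤ b → Differentiable ℝ f → f b = 0 →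
      (∀ x ∈ Set.Icc a b, |deriv f x| ≤ D) → ∀ x ∈ Set.Icc a b, |f x| ≤ D * (b - a) := by
    intro a b D f hab hf hfb hD x hx
    have h := (convex_Icc a b).norm_image_sub_le_of_norm_deriv_le (fun y _ => hf y)
      (fun y hy => by simpa using hD y hy) (Set.right_mem_Icc.2 hab) hx
    rw [hfb, sub_zero, Real.norm_eq_abs, Real.norm_eq_abs, abs_sub_comm,
      abs_of_nonneg (by linarith [hx.2] : 0 ≤ b - x)] at h
    refine h.trans (mul_le_mul_of_nonneg_left (by linarith [hx.1]) ?_)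
    exact (abs_nonneg _).trans (hD x hx)
  induction k with
  | zero =>
    intro a b M hab W hW hM
    refine ⟨C (W b), by simp, by simp, fun x hx => ?_⟩
    have hd : Differentiable ℝ W := hW.differentiable (by simp)
    have := step (f := fun x => W x - W b) (D := M) hab (by fun_prop) (by simp)
      (fun y _ => by simpa [iteratedDeriv_one] using hM y) x hx
    simpa using this
  | succ k ih =>
    intro a b M hab W hW hM
    have hd : Differentiable ℝ W := hW.differentiable (by simp)
    have hW' : ContDiff ℝ (⊤ : ℕ∞) (deriv W) := ContDiff.iterate_deriv 1 hW
    obtain ⟨T', hT'd, -, hT'⟩ := ih hab hW' (fun x => by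
      rw [← iteratedDeriv_succ']
      exact hM x)
    obtain ⟨S, hS, hSd⟩ := exists_derivative_eq_natDegree_le T'
    refine ⟨S + C (W b - S.eval b), ?_, by simp, fun x hx => ?_⟩
    · rw [natDegree_add_C]
      omega
    · have hder : ∀ y, deriv (fun x => W x - (S + C (W b - S.eval b)).eval x) y
          = deriv W y - T'.eval y := by
        intro y
        rw [deriv_fun_sub (hd y) (Polynomial.differentiableAt _), Polynomial.deriv]
        simp [hS]
      have := step (f := fun x => W x - (S + C (W b - S.eval b)).eval x)
        (D := M * (b - a)^(k+1)) hab
        (hd.sub (Polynomial.differentiable _)) (by simp)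
        (fun y hy => by
          rw [hder]
          exact hT' y hy) x hx
      refine this.trans_eq (by ring)

/-- Approximation property of the Gauss–Radau projection. -/
lemma exists_radau_approx_const (k : ℕ) : ∃ K : ℝ, 0 < K ∧ ∀ (a b M : ℝ), a < b →
    ∀ W : ℝ → ℝ, ContDiff ℝ (⊤ : ℕ∞) W → (∀ x, |iteratedDeriv (k+1) W x| ≤ M) →
    ∀ p : ℝ[X], IsGRProj k a b W p →
      ∫ x in a..b, (p.eval x - W x)^2 ≤ K * (M * (b - a)^(k+1))^2 * (b - a) := by
  obtain ⟨K, hK, hstab⟩ := exists_radau_stability_const k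
  refine ⟨2 * K + 2, by positivity, fun a b M hab W hW hM p hp => ?_⟩
  obtain ⟨T, hTd, hTb, hT⟩ := exists_polynomial_approx k hab.le hW hM
  have hWc : Continuous W := hW.continuous
  set E := M * (b - a)^(k+1) with hE
  have hR : ∫ x in a..b, (W x - T.eval x)^2 ≤ E^2 * (b - a) := by
    have : ∫ x in a..b, (W x - T.eval x)^2 ≤ ∫ x in a..b, E^2 := by
      apply intervalIntegral.integral_mono_on hab.le
        (Continuous.intervalIntegrable (by fun_prop) _ _)
        (Continuous.intervalIntegrable (by fun_prop) _ _)
      intro x hx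
      exact sq_le_sq.2 ((hT x hx).trans (le_abs_self _))
    rw [intervalIntegral.integral_const, smul_eq_mul] at this
    linarith
  have hq := hstab a b hab (fun x => W x - T.eval x) (by fun_prop) (p - T)
    ((natDegree_sub_le _ _).trans (max_le hp.1 hTd))
    (by rw [eval_sub, hp.2.2, hTb, sub_self]) (fun v hv => hp.sub_orthogonal hv)
  have hsum : ∫ x in a..b, (p.eval x - W x)^2
      ≤ ∫ x in a..b, (2 * (p - T).eval x ^ 2 + 2 * (W x - T.eval x)^2) := by
    apply intervalIntegral.integral_mono_on hab.le
      (Continuous.intervalIntegrable (by fun_prop) _ _)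
      (Continuous.intervalIntegrable (by fun_prop) _ _)
    intro x _
    rw [eval_sub]
    nlinarith [sq_nonneg ((p.eval x - T.eval x) + (W x - T.eval x))]
  rw [intervalIntegral.integral_add (Continuous.intervalIntegrable (by fun_prop) _ _)
    (Continuous.intervalIntegrable (by fun_prop) _ _), intervalIntegral.integral_const_mul,
    intervalIntegral.integral_const_mul] at hsum
  nlinarith [mul_le_mul_of_nonneg_left hR hK.le]

/-! ### Uniformly smooth families and the reference functions -/

/-- A family of smooth `1`-periodic functions whose derivatives of every order are bounded
uniformly over the family. -/
def UniformlySmooth {ι : Type*} (W : ι → ℝ → ℝ) : Prop :=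
  (∀ i, ContDiff ℝ (⊤ : ℕ∞) (W i)) ∧ (∀ i x, W i (x+1) = W i x) ∧
  ∀ m : ℕ, ∃ M : ℝ, ∀ i x, |iteratedDeriv m (W i) x| ≤ M

namespace UniformlySmooth

variable {ι : Type*} {W W₁ W₂ : ι → ℝ → ℝ}

lemma contDiffAt (h : UniformlySmooth W) (i : ι) (m : ℕ) (x : ℝ) : ContDiffAt ℝ m (W i) x :=
  ((h.1 i).of_le (by exact_mod_cast le_top)).contDiffAt

lemma continuous (h : UniformlySmooth W) (i : ι) : Continuous (W i) := (h.1 i).continuous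

lemma add (h₁ : UniformlySmooth W₁) (h₂ : UniformlySmooth W₂) :
    UniformlySmooth (fun i x => W₁ i x + W₂ i x) := by
  refine ⟨fun i => (h₁.1 i).add (h₂.1 i), fun i x => by simp only [h₁.2.1, h₂.2.1], fun m => ?_⟩
  obtain ⟨M₁, hM₁⟩ := h₁.2.2 m
  obtain ⟨M₂, hM₂⟩ := h₂.2.2 m
  refine ⟨M₁ + M₂, fun i x => ?_⟩
  rw [iteratedDeriv_fun_add (h₁.contDiffAt i m x) (h₂.contDiffAt i m x)]
  exact (abs_add_le _ _).trans (add_le_add (hM₁ i x) (hM₂ i x))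

lemma mul_bounded (h : UniformlySmooth W) {t : ι → ℝ} {B : ℝ} (ht : ∀ i, |t i| ≤ B) :
    UniformlySmooth (fun i x => t i * W i x) := by
  refine ⟨fun i => contDiff_const.mul (h.1 i), fun i x => by simp only [h.2.1], fun m => ?_⟩
  obtain ⟨M, hM⟩ := h.2.2 m
  refine ⟨B * M, fun i x => ?_⟩
  rw [iteratedDeriv_const_mul _ (h.contDiffAt i m x), abs_mul]
  exact mul_le_mul (ht i) (hM i x) (abs_nonneg _) ((abs_nonneg _).trans (ht i))

lemma const_mul (h : UniformlySmooth W) (t : ℝ) : UniformlySmooth (fun i x => t * W i x) :=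
  h.mul_bounded (t := fun _ => t) fun _ => le_refl |t|

lemma sub (h₁ : UniformlySmooth W₁) (h₂ : UniformlySmooth W₂) :
    UniformlySmooth (fun i x => W₁ i x - W₂ i x) := by
  simpa [sub_eq_add_neg] using h₁.add (h₂.const_mul (-1))

lemma sum {κ : Type*} {s : Finset κ} {V : κ → ι → ℝ → ℝ} (h : ∀ m ∈ s, UniformlySmooth (V m)) :
    UniformlySmooth (fun i x => ∑ m ∈ s, V m i x) := by
  classical
  induction s using Finset.induction_on with
  | empty =>
    refine ⟨fun i => by simpa using contDiff_const, fun i x => by simp, fun m => ⟨0, fun i x => ?_⟩⟩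
    simp only [Finset.sum_empty]
    simp
  | insert j s hj ih =>
    simp only [Finset.sum_insert hj]
    exact (h j (mem_insert_self j s)).add (ih fun m hm => h m (mem_insert_of_mem hm))

lemma deriv (h : UniformlySmooth W) : UniformlySmooth (fun i => deriv (W i)) := by
  refine ⟨fun i => ContDiff.iterate_deriv 1 (h.1 i), fun i x => ?_, fun m => ?_⟩
  · beta_reduce
    rw [← deriv_comp_add_const]
    simp only [h.2.1]
  · obtain ⟨M, hM⟩ := h.2.2 (m+1)
    refine ⟨M, fun i x => ?_⟩
    rw [← iteratedDeriv_succ']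
    exact hM i x

lemma of_periodic {f : ℝ → ℝ} (hf : ContDiff ℝ (⊤ : ℕ∞) f) (hp : ∀ x, f (x+1) = f x) :
    UniformlySmooth (fun _ : ι => f) := by
  refine ⟨fun _ => hf, fun _ => hp, fun m => ?_⟩
  have hc : Continuous (iteratedDeriv m f) :=
    hf.continuous_iteratedDeriv m (by exact_mod_cast le_top)
  have hper : Function.Periodic (iteratedDeriv m f) 1 := by
    intro x
    have := congrFun (iteratedDeriv_comp_add_const m f 1) x
    simp only [hp] at this
    exact this.symm
  obtain ⟨M, hM⟩ := (isCompact_Icc (a := (0:ℝ)) (b := 1)).exists_bound_of_continuousOn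
    hc.continuousOn
  refine ⟨M, fun _ x => ?_⟩
  obtain ⟨y, hy, hxy⟩ := hper.exists_mem_Ico₀ one_pos x
  rw [hxy]
  exact hM y ⟨hy.1, hy.2.le⟩

lemma comp_add (h : UniformlySmooth W) (a : ι → ℝ) :
    UniformlySmooth (fun i x => W i (x + a i)) := by
  refine ⟨fun i => (h.1 i).comp (contDiff_id.add contDiff_const), fun i x => ?_, fun m => ?_⟩
  · beta_reduce
    rw [add_right_comm, h.2.1]
  · obtain ⟨M, hM⟩ := h.2.2 m
    refine ⟨M, fun i x => ?_⟩
    rw [iteratedDeriv_comp_add_const]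
    exact hM i _

/-- Difference quotients of a uniformly smooth family are uniformly smooth. -/
lemma diffQuot (h : UniformlySmooth W) {a t : ι → ℝ} {B : ℝ} (ht : ∀ i, 0 < t i)
    (ha : ∀ i, |a i| ≤ B * t i) :
    UniformlySmooth (fun i x => (t i)⁻¹ * (W i (x + a i) - W i x)) := by
  have hs := (h.comp_add a).sub h
  refine ⟨fun i => contDiff_const.mul (hs.1 i), fun i x => congrArg ((t i)⁻¹ * ·) (hs.2.1 i x), fun m => ?_⟩
  obtain ⟨M, hM⟩ := h.2.2 (m+1)
  refine ⟨M * B, fun i x => ?_⟩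
  rw [iteratedDeriv_const_mul _ (hs.contDiffAt i m x),
    iteratedDeriv_fun_sub ((h.comp_add a).contDiffAt i m x) (h.contDiffAt i m x),
    iteratedDeriv_comp_add_const, abs_mul, abs_of_pos (inv_pos.2 (ht i)),
    inv_mul_le_iff₀ (ht i)]
  have hd : Differentiable ℝ (iteratedDeriv m (W i)) :=
    (h.1 i).differentiable_iteratedDeriv m (by exact_mod_cast WithTop.coe_lt_top _)
  have hmv := convex_univ.norm_image_sub_le_of_norm_deriv_le (f := iteratedDeriv m (W i))
    (C := M) (fun y _ => hd y) (fun y _ => by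
      rw [← iteratedDeriv_succ]
      exact hM i y) (Set.mem_univ x) (Set.mem_univ (x + a i))
  rw [Real.norm_eq_abs, add_sub_cancel_left, Real.norm_eq_abs] at hmv
  refine hmv.trans ?_
  calc M * |a i| ≤ M * (B * t i) :=
        mul_le_mul_of_nonneg_left (ha i) ((abs_nonneg _).trans (hM i x))
    _ = t i * (M * B) := by ring

end UniformlySmooth

lemma IsSmoothSolution.eq_translate {β : ℝ} {u : ℝ → ℝ → ℝ} (hu : IsSmoothSolution β u)
    (x t : ℝ) : u x t = u (x + -(β * t)) 0 := by
  obtain ⟨hsm, -, heq⟩ := hu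
  have hd : Differentiable ℝ (fun p : ℝ × ℝ => u p.1 p.2) := hsm.differentiable (by simp)
  have key : ∀ y s, HasDerivAt (fun s => u (y + β * s) s) 0 s := by
    intro y s
    set D := fderiv ℝ (fun p : ℝ × ℝ => u p.1 p.2) (y + β * s, s) with hD
    have hF : HasFDerivAt (fun p : ℝ × ℝ => u p.1 p.2) D (y + β * s, s) :=
      (hd (y + β * s, s)).hasFDerivAt
    have h1 : HasDerivAt (fun r => u (y + β * s) r) (D (0, 1)) s :=
      hF.comp_hasDerivAt (f := fun r : ℝ => (y + β * s, r)) s ((hasDerivAt_const s (y + β * s)).prodMk (hasDerivAt_id s))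
    have h2 : HasDerivAt (fun z => u z s) (D (1, 0)) (y + β * s) :=
      hF.comp_hasDerivAt (f := fun z : ℝ => (z, s)) (y + β * s)
        ((hasDerivAt_id (y + β * s)).prodMk (hasDerivAt_const (y + β * s) s))
    have h3 : HasDerivAt (fun r : ℝ => y + β * r) β s := by
      simpa using ((hasDerivAt_id s).const_mul β).const_add y
    have h4 : HasDerivAt (fun r => u (y + β * r) r) (D (β, 1)) s :=
      hF.comp_hasDerivAt (f := fun r : ℝ => (y + β * r, r)) s (h3.prodMk (hasDerivAt_id s))
    have h5 := heq (y + β * s) s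
    rw [h1.deriv, h2.deriv] at h5
    have h6 : D (β, 1) = D (0, 1) + β * D (1, 0) := by
      rw [← smul_eq_mul β, ← map_smul, ← map_add]
      simp
    rw [h6, h5] at h4
    exact h4
  have hc := is_const_of_deriv_eq_zero (f := fun s => u (x + -(β * t) + β * s) s)
    (fun s => (key _ s).differentiableAt) (fun s => (key _ s).deriv) t 0
  simpa using hc

lemma UrefUpTo_eq_Uref (u : ℝ → ℝ → ℝ) (c d : ℕ → ℕ → ℝ) (β τ : ℝ) (n : ℕ) {i ℓ : ℕ}
    (h : i ≤ ℓ) : UrefUpTo u c d β τ n ℓ i = Uref u c d β τ n i := by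
  induction ℓ with
  | zero =>
    obtain rfl := Nat.le_zero.1 h
    rfl
  | succ ℓ ih =>
    rcases Nat.lt_or_eq_of_le h with h' | rfl
    · rw [← ih (Nat.lt_succ_iff.1 h'), UrefUpTo]
      exact if_pos (Nat.lt_succ_iff.1 h')
    · rfl

lemma Uref_succ (u : ℝ → ℝ → ℝ) (c d : ℕ → ℕ → ℝ) (β τ : ℝ) (n ℓ : ℕ) :
    Uref u c d β τ n (ℓ+1) = fun x => ∑ m ∈ range (ℓ+1),
      (c ℓ m * Uref u c d β τ n m x - τ * d ℓ m * β * deriv (Uref u c d β τ n m) x) := by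
  rw [Uref, UrefUpTo]
  beta_reduce
  rw [if_neg (by omega)]
  funext x
  refine Finset.sum_congr rfl fun m hm => ?_
  rw [UrefUpTo_eq_Uref _ _ _ _ _ _ (Nat.lt_succ_iff.1 (mem_range.1 hm))]

/-- The parameters `(τ, n)` over which the estimates are uniform. -/
abbrev StepParam := Set.Ioc (0:ℝ) 1 × ℕ

section Reference

variable {u : ℝ → ℝ → ℝ} {c d : ℕ → ℕ → ℝ} {β : ℝ} {s : ℕ}

lemma IsSmoothSolution.uniformlySmooth (hu : IsSmoothSolution β u) {ι : Type*} (t : ι → ℝ) :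
    UniformlySmooth (fun i x => u x (t i)) := by
  have hf : ContDiff ℝ (⊤ : ℕ∞) (fun x => u x 0) :=
    hu.1.comp (contDiff_id.prodMk contDiff_const)
  have h := (UniformlySmooth.of_periodic (ι := ι) hf (fun x => hu.2.1 x 0)).comp_add
    (fun i => -(β * t i))
  have e : (fun i x => u x (t i)) = fun i x => u (x + -(β * t i)) 0 := by
    funext i x
    exact hu.eq_translate x (t i)
  rw [e]
  exact h

lemma Uref_eq_add (hu : IsSmoothSolution β u)
    (hc : ∀ ℓ < s, ∑ m ∈ Finset.range (ℓ+1), c ℓ m = 1) (m : ℕ) (hm : m ≤ s) :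
    ∃ V : StepParam → ℝ → ℝ, UniformlySmooth V ∧ ∀ i : StepParam,
      Uref u c d β i.1 i.2 m = fun x => u x (i.2 * i.1) + i.1 * V i x := by
  induction m using Nat.strong_induction_on with
  | _ m ih =>
  rcases m with _ | ℓ
  · refine ⟨fun _ _ => 0, UniformlySmooth.of_periodic contDiff_const (by simp), fun i => ?_⟩
    simp [Uref, UrefUpTo]
  · choose! V hV hVe using fun m (hm' : m < ℓ + 1) => ih m hm' (by omega)
    have hτ : ∀ i : StepParam, |(i.1 : ℝ)| ≤ 1 := by
      intro i
      rw [abs_of_pos i.1.2.1]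
      exact i.1.2.2
    have hU : ∀ m < ℓ + 1, UniformlySmooth (fun i : StepParam => Uref u c d β i.1 i.2 m) := by
      intro m hm'
      have e : (fun i : StepParam => Uref u c d β i.1 i.2 m)
          = fun i x => u x (i.2 * i.1) + i.1 * V m i x := by
        funext i
        exact hVe m hm' i
      rw [e]
      exact (hu.uniformlySmooth fun i : StepParam => (i.2 * i.1 : ℝ)).add
        ((hV m hm').mul_bounded (t := fun i : StepParam => (i.1 : ℝ)) hτ)
    refine ⟨fun i x => ∑ m ∈ range (ℓ+1),
      (c ℓ m * V m i x - (d ℓ m * β) * deriv (Uref u c d β i.1 i.2 m) x), ?_, fun i => ?_⟩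
    · exact UniformlySmooth.sum fun m hm' => ((hV m (mem_range.1 hm')).const_mul _).sub
        ((hU m (mem_range.1 hm')).deriv.const_mul _)
    · rw [Uref_succ]
      funext x
      have h1 : u x (i.2 * i.1) = ∑ m ∈ range (ℓ+1), c ℓ m * u x (i.2 * i.1) := by
        rw [← Finset.sum_mul, hc ℓ (by omega), one_mul]
      rw [h1, Finset.mul_sum, ← Finset.sum_add_distrib]
      refine Finset.sum_congr rfl fun m hm' => ?_
      rw [congrFun (hVe m (mem_range.1 hm') i) x]
      ring

lemma uniformlySmooth_Uref (hu : IsSmoothSolution β u)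
    (hc : ∀ ℓ < s, ∑ m ∈ Finset.range (ℓ+1), c ℓ m = 1) {m : ℕ} (hm : m ≤ s) :
    UniformlySmooth (fun i : StepParam => Uref u c d β i.1 i.2 m) := by
  obtain ⟨V, hV, hVe⟩ := Uref_eq_add (d := d) hu hc m hm
  rw [funext hVe]
  refine (hu.uniformlySmooth fun i : StepParam => (i.2 * i.1 : ℝ)).add
    (hV.mul_bounded (t := fun i : StepParam => (i.1 : ℝ)) (B := 1) fun i => ?_)
  rw [abs_of_pos i.1.2.1]
  exact i.1.2.2

lemma rkRes_eq (hs : 1 ≤ s) (τ : ℝ) (n : ℕ) :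
    rkRes u c d β τ s n
      = fun x => (u x (((n:ℝ)+1) * τ) - Uref u c d β τ n s x) / τ := by
  obtain ⟨ℓ, rfl⟩ : ∃ ℓ, s = ℓ + 1 := ⟨s - 1, by omega⟩
  funext x
  rw [rkRes, Uref_succ]
  simp

lemma uniformlySmooth_rkRes (hβ : 0 < β) (hs : 1 ≤ s) (hu : IsSmoothSolution β u)
    (hc : ∀ ℓ < s, ∑ m ∈ Finset.range (ℓ+1), c ℓ m = 1) :
    UniformlySmooth (fun i : StepParam => rkRes u c d β i.1 s i.2) := by
  obtain ⟨V, hV, hVe⟩ := Uref_eq_add (d := d) hu hc s le_rfl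
  have hD := (hu.uniformlySmooth fun i : StepParam => (i.2 * i.1 : ℝ)).diffQuot
    (a := fun i => -(β * i.1)) (t := fun i => (i.1 : ℝ)) (B := β) (fun i => i.1.2.1)
    (fun i => by rw [abs_neg, abs_of_pos (mul_pos hβ i.1.2.1)])
  have e : (fun i : StepParam => rkRes u c d β i.1 s i.2)
      = fun i x => (i.1 : ℝ)⁻¹ * (u (x + -(β * i.1)) (i.2 * i.1) - u x (i.2 * i.1)) - V i x := by
    funext i x
    have hτ : (i.1 : ℝ) ≠ 0 := i.1.2.1.ne'
    have h1 : u x (((i.2:ℝ)+1) * i.1) = u (x + -(β * i.1)) (i.2 * i.1) := by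
      rw [hu.eq_translate x, hu.eq_translate (x + -(β * i.1)) (i.2 * i.1)]
      congr 1
      ring
    rw [rkRes_eq hs, hVe i]
    beta_reduce
    rw [h1]
    field_simp
    ring
  rw [e]
  exact hD.sub hV

end Reference

/-! ### Meshes and discrete norms -/

section Mesh

variable {pt : Fin (N+1) → ℝ}

lemma IsMesh.ptL_lt_ptR (h : IsMesh pt) (j : Fin N) : ptL pt j < ptR pt j :=
  h.2.2 (Fin.castSucc_lt_succ)

lemma IsMesh.cellh_pos (h : IsMesh pt) (j : Fin N) : 0 < cellh pt j :=
  sub_pos.2 (h.ptL_lt_ptR j)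

lemma cellh_le_meshSize (pt : Fin (N+1) → ℝ) (j : Fin N) : cellh pt j ≤ meshSize pt :=
  le_ciSup (f := fun j => cellh pt j) (Set.finite_range _).bddAbove j

lemma IsMesh.meshSize_pos [NeZero N] (h : IsMesh pt) : 0 < meshSize pt :=
  (h.cellh_pos 0).trans_le (cellh_le_meshSize pt 0)

lemma IsMesh.sum_integral (h : IsMesh pt) {f : ℝ → ℝ} (hf : Continuous f) :
    ∑ j : Fin N, ∫ x in (ptL pt j)..(ptR pt j), f x = ∫ x in (0:ℝ)..1, f x := by
  let a : ℕ → ℝ := fun i => if hi : i < N + 1 then pt ⟨i, hi⟩ else 0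
  have h1 := intervalIntegral.sum_integral_adjacent_intervals (f := f) (μ := volume) (a := a)
    (n := N) (fun _ _ => hf.intervalIntegrable _ _)
  have h0 : a 0 = 0 := by simpa [a] using h.1
  have hN : a N = 1 := by simpa [a, Fin.last] using h.2.1
  rw [h0, hN, Finset.sum_range] at h1
  rw [← h1]
  refine Finset.sum_congr rfl fun j _ => ?_
  have hL : a j = ptL pt j := by
    simp only [a, ptL, dif_pos (j.2.trans (Nat.lt_succ_self N))]
    rfl
  have hR : a (j+1) = ptR pt j := by
    simp only [a, ptR, dif_pos (Nat.succ_lt_succ j.2)]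
    rfl
  rw [hL, hR]

lemma IsMesh.sum_cellh (h : IsMesh pt) : ∑ j : Fin N, cellh pt j = 1 := by
  have := h.sum_integral (f := fun _ => 1) continuous_const
  simpa [cellh] using this

lemma IsMesh.apply_ptL_of_periodic [NeZero N] (h : IsMesh pt) {U : ℝ → ℝ}
    (hU : ∀ x, U (x+1) = U x) (j : Fin N) : U (pt (j-1).succ) = U (ptL pt j) := by
  obtain ⟨n, rfl⟩ : ∃ n, N = n + 1 := ⟨N - 1, by have := NeZero.ne N; omega⟩
  by_cases hj : j = 0
  · subst hj
    have e : (0 - 1 : Fin (n+1)).succ = Fin.last (n+1) := by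
      ext
      simp
    have e' : ptL pt 0 = 0 := h.1
    rw [e, h.2.1, e', ← hU 0, zero_add]
  · have e : (j - 1).succ = j.castSucc := by
      ext
      have : (j:ℕ) ≠ 0 := fun h0 => hj (Fin.ext h0)
      simp only [Fin.val_succ, Fin.coe_sub_one, if_neg hj, Fin.val_castSucc]
      omega
    rw [e]
    rfl

lemma cip_self (pt : Fin (N+1) → ℝ) (j : Fin N) (p : ℝ[X]) :
    cip pt j p p = ∫ x in (ptL pt j)..(ptR pt j), p.eval x ^ 2 := by
  simp only [cip, sq]

lemma IsMesh.cip_self_nonneg (h : IsMesh pt) (j : Fin N) (p : ℝ[X]) : 0 ≤ cip pt j p p := by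
  rw [cip_self]
  exact intervalIntegral.integral_nonneg (h.ptL_lt_ptR j).le fun x _ => sq_nonneg _

lemma IsMesh.sq_cl2 (h : IsMesh pt) (j : Fin N) (p : ℝ[X]) :
    cl2 pt j p ^ 2 = ∫ x in (ptL pt j)..(ptR pt j), p.eval x ^ 2 := by
  rw [cl2, Real.sq_sqrt (h.cip_self_nonneg j p), cip_self]

lemma cl2_nonneg (pt : Fin (N+1) → ℝ) (j : Fin N) (p : ℝ[X]) : 0 ≤ cl2 pt j p :=
  Real.sqrt_nonneg _

lemma l2_nonneg (pt : Fin (N+1) → ℝ) (u : Fin N → ℝ[X]) : 0 ≤ l2 pt u := Real.sqrt_nonneg _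

lemma IsMesh.sq_l2 (h : IsMesh pt) (u : Fin N → ℝ[X]) :
    l2 pt u ^ 2 = ∑ j, cl2 pt j (u j) ^ 2 := by
  rw [l2, ip, Real.sq_sqrt (Finset.sum_nonneg fun j _ => h.cip_self_nonneg j _)]
  exact Finset.sum_congr rfl fun j _ => by rw [h.sq_cl2, cip_self]

lemma cip_add_left (pt : Fin (N+1) → ℝ) (j : Fin N) (p q v : ℝ[X]) :
    cip pt j (p + q) v = cip pt j p v + cip pt j q v := by
  simp only [cip, eval_add, add_mul]
  exact intervalIntegral.integral_add (Continuous.intervalIntegrable (by fun_prop) _ _)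
    (Continuous.intervalIntegrable (by fun_prop) _ _)

lemma cip_C_mul_left (pt : Fin (N+1) → ℝ) (j : Fin N) (t : ℝ) (p v : ℝ[X]) :
    cip pt j (C t * p) v = t * cip pt j p v := by
  simp only [cip, eval_mul, eval_C, mul_assoc]
  exact intervalIntegral.integral_const_mul _ _

lemma cip_comm (pt : Fin (N+1) → ℝ) (j : Fin N) (p q : ℝ[X]) :
    cip pt j p q = cip pt j q p := by
  simp only [cip, mul_comm]

lemma ip_add_mul_self (pt : Fin (N+1) → ℝ) (u v : Fin N → ℝ[X]) (t : ℝ) :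
    ip pt (fun j => u j + C t * v j) (fun j => u j + C t * v j)
      = ip pt u u + 2 * t * ip pt u v + t^2 * ip pt v v := by
  simp only [ip, Finset.mul_sum, ← Finset.sum_add_distrib]
  refine Finset.sum_congr rfl fun j _ => ?_
  rw [cip_add_left, cip_C_mul_left, cip_comm pt j (u j), cip_comm pt j (v j), cip_add_left,
    cip_add_left, cip_C_mul_left, cip_C_mul_left, cip_comm pt j (v j) (u j)]
  ring

lemma IsMesh.ip_self_nonneg (h : IsMesh pt) (u : Fin N → ℝ[X]) : 0 ≤ ip pt u u :=
  Finset.sum_nonneg fun j _ => h.cip_self_nonneg j _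

lemma IsMesh.ip_le (h : IsMesh pt) (u v : Fin N → ℝ[X]) : ip pt u v ≤ l2 pt u * l2 pt v := by
  rw [l2, l2, ← Real.sqrt_mul (h.ip_self_nonneg u)]
  apply Real.le_sqrt_of_sq_le
  apply sq_le_mul_of_forall_quadratic_nonneg
  intro t
  rw [← ip_add_mul_self]
  exact h.ip_self_nonneg _

lemma IsMesh.l2_add_le (h : IsMesh pt) (u v : Fin N → ℝ[X]) :
    l2 pt (fun j => u j + v j) ≤ l2 pt u + l2 pt v := by
  have h1 := ip_add_mul_self pt u v 1
  simp only [C_1, one_mul] at h1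
  rw [l2, Real.sqrt_le_left (add_nonneg (l2_nonneg _ _) (l2_nonneg _ _)), h1]
  have hu : l2 pt u ^ 2 = ip pt u u := Real.sq_sqrt (h.ip_self_nonneg u)
  have hv : l2 pt v ^ 2 = ip pt v v := Real.sq_sqrt (h.ip_self_nonneg v)
  nlinarith [h.ip_le u v]

lemma l2_C_mul (pt : Fin (N+1) → ℝ) (t : ℝ) (u : Fin N → ℝ[X]) :
    l2 pt (fun j => C t * u j) = |t| * l2 pt u := by
  have : ip pt (fun j => C t * u j) (fun j => C t * u j) = t^2 * ip pt u u := by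
    simp only [ip, Finset.mul_sum]
    refine Finset.sum_congr rfl fun j _ => ?_
    rw [cip_C_mul_left, cip_comm, cip_C_mul_left]
    ring
  rw [l2, this, Real.sqrt_mul (sq_nonneg t), Real.sqrt_sq_eq_abs, l2]

lemma IsMesh.l2_sum_le (h : IsMesh pt) {ι : Type*} (s : Finset ι) (v : ι → Fin N → ℝ[X]) :
    l2 pt (fun j => ∑ i ∈ s, v i j) ≤ ∑ i ∈ s, l2 pt (v i) := by
  classical
  induction s using Finset.induction_on with
  | empty => simp [l2, ip, cip]
  | insert i s his ih =>
    simp only [Finset.sum_insert his]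
    exact (h.l2_add_le (v i) (fun j => ∑ i ∈ s, v i j)).trans (by gcongr)

lemma IsMesh.abs_integral_mul_le (h : IsMesh pt) (j : Fin N) {f : ℝ → ℝ} (hf : Continuous f)
    (v : ℝ[X]) {A : ℝ} (hA : 0 ≤ A) (hfA : ∫ x in (ptL pt j)..(ptR pt j), f x ^ 2 ≤ A^2) :
    |∫ x in (ptL pt j)..(ptR pt j), f x * v.eval x| ≤ A * cl2 pt j v := by
  apply abs_le_of_sq_le_sq _ (mul_nonneg hA (cl2_nonneg _ _ _))
  refine (sq_integral_mul_le hf v.continuous (h.ptL_lt_ptR j).le).trans ?_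
  rw [mul_pow, h.sq_cl2]
  exact mul_le_mul_of_nonneg_right hfA
    (intervalIntegral.integral_nonneg (h.ptL_lt_ptR j).le fun x _ => sq_nonneg _)

end Mesh

/-! ### The upwind DG operator -/

section DG

variable [NeZero N] {pt : Fin (N+1) → ℝ}

lemma dgRHS_sub (pt : Fin (N+1) → ℝ) (β : ℝ) (w p : Fin N → ℝ[X]) (j : Fin N) (v : ℝ[X]) :
    dgRHS pt β (fun i => w i - p i) j v = dgRHS pt β w j v - dgRHS pt β p j v := by
  simp only [dgRHS, eval_sub, sub_mul]
  rw [intervalIntegral.integral_sub (Continuous.intervalIntegrable (by fun_prop) _ _)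
    (Continuous.intervalIntegrable (by fun_prop) _ _)]
  ring

/-- Consistency: on a Gauss–Radau projection the upwind form reproduces `-β ∫ U' v`. -/
lemma dgRHS_radau {k : ℕ} (hm : IsMesh pt) (β : ℝ) {U : ℝ → ℝ} (hU : ContDiff ℝ (⊤ : ℕ∞) U)
    (hper : ∀ x, U (x+1) = U x) {p : Fin N → ℝ[X]}
    (hp : ∀ j, IsGRProj k (ptL pt j) (ptR pt j) U (p j)) (j : Fin N) {v : ℝ[X]}
    (hv : v.natDegree ≤ k) :
    dgRHS pt β p j v = -(β * ∫ x in (ptL pt j)..(ptR pt j), deriv U x * v.eval x) := by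
  have hUc : Continuous U := hU.continuous
  have hU' : Continuous (deriv U) := (ContDiff.iterate_deriv 1 hU).continuous
  have horth : ∫ x in (ptL pt j)..(ptR pt j), (U x - (p j).eval x) * (derivative v).eval x
      = 0 := by
    by_cases h0 : v.natDegree = 0
    · rw [derivative_of_natDegree_zero h0]
      simp
    · exact (hp j).2.1 _ ((natDegree_derivative_lt h0).trans_le hv)
  simp only [sub_mul] at horth
  rw [intervalIntegral.integral_sub (Continuous.intervalIntegrable (by fun_prop) _ _)
    (Continuous.intervalIntegrable (by fun_prop) _ _)] at horth
  have hibp : ∫ x in (ptL pt j)..(ptR pt j), U x * (derivative v).eval x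
      = U (ptR pt j) * v.eval (ptR pt j) - U (ptL pt j) * v.eval (ptL pt j)
        - ∫ x in (ptL pt j)..(ptR pt j), deriv U x * v.eval x :=
    intervalIntegral.integral_mul_deriv_eq_deriv_mul
      (fun x _ => ((hU.differentiable (by simp)) x).hasDerivAt)
      (fun x _ => v.hasDerivAt x) (hU'.intervalIntegrable _ _)
      (Continuous.intervalIntegrable (by fun_prop) _ _)
  have hL : (p (j-1)).eval (pt (j-1).succ) = U (ptL pt j) :=
    ((hp (j-1)).2.2).trans (hm.apply_ptL_of_periodic hper j)
  rw [dgRHS, hL, (hp j).2.2, ← sub_eq_zero.1 horth, hibp]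
  ring

/-- Boundedness of the upwind form given trace and inverse inequalities with factor `Q`. -/
lemma abs_dgRHS_le {k : ℕ} (hm : IsMesh pt) {β Q : ℝ} (hβ : 0 < β) (hQ : 0 < Q)
    (htr : ∀ p : ℝ[X], p.natDegree ≤ k → ∀ j, ∀ x ∈ Set.Icc (ptL pt j) (ptR pt j),
      p.eval x ^ 2 ≤ Q * cl2 pt j p ^ 2)
    (hinv : ∀ p : ℝ[X], p.natDegree ≤ k → ∀ j, cl2 pt j (derivative p) ≤ Q * cl2 pt j p)
    {w : Fin N → ℝ[X]} (hw : MemVk k w) (j : Fin N) {v : ℝ[X]} (hv : v.natDegree ≤ k) :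
    |dgRHS pt β w j v|
      ≤ β * Q * (2 * cl2 pt j (w j) + cl2 pt (j-1) (w (j-1))) * cl2 pt j v := by
  have hmul : ∀ (i i' : Fin N) (p q : ℝ[X]), p.natDegree ≤ k → q.natDegree ≤ k →
      ∀ x ∈ Set.Icc (ptL pt i) (ptR pt i), ∀ y ∈ Set.Icc (ptL pt i') (ptR pt i'),
      |p.eval x * q.eval y| ≤ Q * cl2 pt i p * cl2 pt i' q := by
    intro i i' p q hp hq x hx y hy
    apply abs_le_of_sq_le_sq _
      (mul_nonneg (mul_nonneg hQ.le (cl2_nonneg _ _ _)) (cl2_nonneg _ _ _))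
    calc (p.eval x * q.eval y)^2 = p.eval x ^ 2 * q.eval y ^ 2 := mul_pow _ _ _
      _ ≤ (Q * cl2 pt i p ^ 2) * (Q * cl2 pt i' q ^ 2) :=
        mul_le_mul (htr p hp i x hx) (htr q hq i' y hy) (sq_nonneg _) (by positivity)
      _ = _ := by ring
  have hLm : ∀ i : Fin N, ptL pt i ∈ Set.Icc (ptL pt i) (ptR pt i) :=
    fun i => Set.left_mem_Icc.2 (hm.ptL_lt_ptR i).le
  have hRm : ∀ i : Fin N, ptR pt i ∈ Set.Icc (ptL pt i) (ptR pt i) :=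
    fun i => Set.right_mem_Icc.2 (hm.ptL_lt_ptR i).le
  have h1 : |∫ x in (ptL pt j)..(ptR pt j), (w j).eval x * (derivative v).eval x|
      ≤ Q * cl2 pt j (w j) * cl2 pt j v := by
    refine (hm.abs_integral_mul_le j (w j).continuous _ (cl2_nonneg pt j (w j))
      (hm.sq_cl2 j (w j)).ge).trans ?_
    nlinarith [mul_le_mul_of_nonneg_left (hinv v hv j) (cl2_nonneg pt j (w j))]
  have h2 := hmul j j (w j) v (hw j) hv _ (hRm j) _ (hRm j)
  have h3 := hmul (j-1) j (w (j-1)) v (hw _) hv _ (hRm (j-1)) _ (hLm j)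
  have e : dgRHS pt β w j v
      = β * ((∫ x in (ptL pt j)..(ptR pt j), (w j).eval x * (derivative v).eval x)
        - (w j).eval (ptR pt j) * v.eval (ptR pt j)
        + (w (j-1)).eval (ptR pt (j-1)) * v.eval (ptL pt j)) := by
    rw [dgRHS, ptR, ptR]
    ring
  rw [e, abs_mul, abs_of_pos hβ, mul_assoc, mul_assoc]
  refine mul_le_mul_of_nonneg_left ?_ hβ.le
  refine (abs_add_le _ _).trans ((add_le_add (abs_sub _ _) le_rfl).trans ?_)
  linarith

/-- Quasi-uniform trace and inverse inequalities on a mesh. -/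
lemma exists_mesh_inverse_const (k : ℕ) {γ : ℝ} (hγ : 1 ≤ γ) : ∃ K : ℝ, 0 < K ∧
    ∀ (N : ℕ) [NeZero N] (pt : Fin (N+1) → ℝ), IsMesh pt → QuasiUniform pt γ →
      ∀ p : ℝ[X], p.natDegree ≤ k → ∀ j,
        (∀ x ∈ Set.Icc (ptL pt j) (ptR pt j),
          p.eval x ^ 2 ≤ K / meshSize pt * cl2 pt j p ^ 2) ∧
        cl2 pt j (derivative p) ≤ K / meshSize pt * cl2 pt j p := by
  obtain ⟨K, hK, hinv⟩ := exists_inverse_const k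
  refine ⟨(K + 1) * γ, by positivity, fun N _ pt hm hq p hp j => ?_⟩
  obtain ⟨htr, hder, -⟩ := hinv p hp _ _ (hm.ptL_lt_ptR j)
  have hh := hm.meshSize_pos
  have hj := hm.cellh_pos j
  have hqj := hq j
  rw [← hm.sq_cl2] at htr hder
  rw [← hm.sq_cl2] at hder
  change ∀ x ∈ _, cellh pt j * _ ≤ _ at htr
  change cellh pt j ^ 2 * _ ≤ _ at hder
  refine ⟨fun x hx => ?_, ?_⟩
  · rw [div_mul_eq_mul_div, le_div_iff₀ hh]
    have h1 := htr x hx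
    calc p.eval x ^ 2 * meshSize pt ≤ p.eval x ^ 2 * (γ * cellh pt j) := by gcongr
      _ = γ * (cellh pt j * p.eval x ^ 2) := by ring
      _ ≤ γ * (K * cl2 pt j p ^ 2) := by gcongr
      _ ≤ (K + 1) * γ * cl2 pt j p ^ 2 := by nlinarith [sq_nonneg (cl2 pt j p)]
  · rw [div_mul_eq_mul_div, le_div_iff₀ hh]
    have h0 := cl2_nonneg pt j (derivative p)
    have h0' := cl2_nonneg pt j p
    apply le_of_sq_le_sq _ (by positivity)
    calc (cl2 pt j (derivative p) * meshSize pt)^2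
        ≤ (cl2 pt j (derivative p) * (γ * cellh pt j))^2 := by gcongr
      _ = γ^2 * (cellh pt j ^ 2 * cl2 pt j (derivative p) ^ 2) := by ring
      _ ≤ γ^2 * (K * cl2 pt j p ^ 2) := by gcongr
      _ ≤ γ^2 * ((K + 1)^2 * cl2 pt j p ^ 2) := by
        gcongr
        nlinarith
      _ = ((K + 1) * γ * cl2 pt j p)^2 := by ring

end DG

/-! ### Stage errors -/

/-- Gauss–Radau approximation on the cells of a mesh. -/
lemma exists_mesh_radau_const (k : ℕ) : ∃ K : ℝ, 0 < K ∧
    ∀ (N : ℕ) (pt : Fin (N+1) → ℝ), IsMesh pt → ∀ (W : ℝ → ℝ) (M : ℝ),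
      ContDiff ℝ (⊤ : ℕ∞) W → (∀ x, |iteratedDeriv (k+1) W x| ≤ M) →
      ∀ (q : Fin N → ℝ[X]), (∀ j, IsGRProj k (ptL pt j) (ptR pt j) W (q j)) → ∀ j,
        ∫ x in (ptL pt j)..(ptR pt j), ((q j).eval x - W x)^2
          ≤ (K * M * meshSize pt ^ (k+1))^2 * cellh pt j := by
  obtain ⟨K, hK, happ⟩ := exists_radau_approx_const k
  refine ⟨K + 1, by positivity, fun N pt hm W M hW hM q hq j => ?_⟩
  have hM0 : 0 ≤ M := (abs_nonneg _).trans (hM 0)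
  have hj := hm.cellh_pos j
  have hle := cellh_le_meshSize pt j
  refine (happ _ _ M (hm.ptL_lt_ptR j) W hW hM (q j) (hq j)).trans ?_
  change K * (M * cellh pt j ^ (k+1))^2 * cellh pt j ≤ _
  refine mul_le_mul_of_nonneg_right ?_ hj.le
  calc K * (M * cellh pt j ^ (k+1))^2 ≤ (K+1)^2 * (M * meshSize pt ^ (k+1))^2 := by
        gcongr
        nlinarith
    _ = _ := by ring

/-- Estimate of the spatial residual: `L w + β P* ∂ₓU` is controlled by `w - P* U`. -/
lemma exists_dg_residual_const (k : ℕ) {β γ : ℝ} (hβ : 0 < β) (hγ : 1 ≤ γ) : ∃ K : ℝ, 0 < K ∧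
    ∀ (N : ℕ) [NeZero N] (pt : Fin (N+1) → ℝ), IsMesh pt → QuasiUniform pt γ →
      ∀ L : (Fin N → ℝ[X]) → (Fin N → ℝ[X]), IsDGOp k pt β L →
      ∀ (U : ℝ → ℝ) (M : ℝ), ContDiff ℝ (⊤ : ℕ∞) U → (∀ x, U (x+1) = U x) →
        (∀ x, |iteratedDeriv (k+1) (deriv U) x| ≤ M) →
      ∀ (w p q : Fin N → ℝ[X]), MemVk k w →
        (∀ j, IsGRProj k (ptL pt j) (ptR pt j) U (p j)) →
        (∀ j, IsGRProj k (ptL pt j) (ptR pt j) (deriv U) (q j)) →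
        l2 pt (fun j => L w j + C β * q j)
          ≤ K / meshSize pt * l2 pt (fun j => w j - p j) + K * M * meshSize pt ^ (k+1) := by
  obtain ⟨K₁, hK₁, hinv⟩ := exists_mesh_inverse_const k hγ
  obtain ⟨K₂, hK₂, happ⟩ := exists_mesh_radau_const k
  refine ⟨4 * β * K₁ + 2 * β * K₂, by positivity, ?_⟩
  intro N _ pt hm hqu L hL U M hU hper hM w p q hw hp hq
  have hh := hm.meshSize_pos
  have hU' : ContDiff ℝ (⊤ : ℕ∞) (deriv U) := ContDiff.iterate_deriv 1 hU
  have hU'c : Continuous (deriv U) := hU'.continuous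
  have hM0 : 0 ≤ M := (abs_nonneg _).trans (hM 0)
  set Q : ℝ := K₁ / meshSize pt with hQ
  have hQ0 : 0 < Q := div_pos hK₁ hh
  set A : ℝ := K₂ * M * meshSize pt ^ (k+1) with hA
  have hA0 : 0 ≤ A := by positivity
  set ξ : Fin N → ℝ[X] := fun j => w j - p j with hξ
  set Z : Fin N → ℝ[X] := fun j => L w j + C β * q j with hZ
  have hξV : MemVk k ξ := fun j => (natDegree_sub_le _ _).trans (max_le (hw j) (hp j).1)
  have hZV : MemVk k Z := fun j => (natDegree_add_le _ _).trans
    (max_le ((hL w hw).1 j) ((natDegree_C_mul_le _ _).trans (hq j).1))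
  have hcell : ∀ j, cl2 pt j (Z j) ≤
      β * Q * (2 * cl2 pt j (ξ j) + cl2 pt (j-1) (ξ (j-1))) + β * (A * √(cellh pt j)) := by
    intro j
    have hid : cl2 pt j (Z j) ^ 2 = dgRHS pt β ξ j (Z j)
        + β * ∫ x in (ptL pt j)..(ptR pt j), ((q j).eval x - deriv U x) * (Z j).eval x := by
      have e1 : cip pt j (Z j) (Z j) = dgRHS pt β w j (Z j) + β * cip pt j (q j) (Z j) := by
        rw [← (hL w hw).2 j (Z j) (hZV j), ← cip_C_mul_left, ← cip_add_left]
      have e2 : ∫ x in (ptL pt j)..(ptR pt j), ((q j).eval x - deriv U x) * (Z j).eval x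
          = cip pt j (q j) (Z j)
            - ∫ x in (ptL pt j)..(ptR pt j), deriv U x * (Z j).eval x := by
        simp only [sub_mul, cip]
        exact intervalIntegral.integral_sub (Continuous.intervalIntegrable (by fun_prop) _ _)
          (Continuous.intervalIntegrable (by fun_prop) _ _)
      rw [hm.sq_cl2, ← cip_self, e1, e2, hξ, dgRHS_sub,
        dgRHS_radau hm β hU hper hp j (hZV j)]
      ring
    have h1 := abs_dgRHS_le hm hβ hQ0 (fun p hp j => (hinv N pt hm hqu p hp j).1)
      (fun p hp j => (hinv N pt hm hqu p hp j).2) hξV j (hZV j)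
    have h2 := hm.abs_integral_mul_le j (f := fun x => (q j).eval x - deriv U x) (by fun_prop)
      (Z j) (A := A * √(cellh pt j)) (by positivity) (by
        rw [mul_pow, Real.sq_sqrt (hm.cellh_pos j).le]
        exact happ N pt hm _ M hU' hM q hq j)
    rcases (cl2_nonneg pt j (Z j)).eq_or_lt with h0 | h0
    · rw [← h0]
      have := cl2_nonneg pt j (ξ j)
      have := cl2_nonneg pt (j-1) (ξ (j-1))
      positivity
    · refine le_of_mul_le_mul_right ?_ h0
      have h3 := le_of_abs_le h1
      have h4 := mul_le_mul_of_nonneg_left (le_of_abs_le h2) hβ.le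
      nlinarith
  have hsum : l2 pt Z ^ 2 ≤ 15 * (β * Q * l2 pt ξ)^2 + 3 * (β * A)^2 := by
    have hshift : ∑ j : Fin N, cl2 pt (j-1) (ξ (j-1)) ^ 2 = ∑ j : Fin N, cl2 pt j (ξ j) ^ 2 :=
      (Equiv.subRight (1 : Fin N)).sum_comp (fun j => cl2 pt j (ξ j) ^ 2)
    have hsq : ∀ j ∈ (Finset.univ : Finset (Fin N)), cl2 pt j (Z j) ^ 2 ≤
        12 * (β * Q)^2 * cl2 pt j (ξ j) ^ 2 + 3 * (β * Q)^2 * cl2 pt (j-1) (ξ (j-1)) ^ 2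
          + 3 * (β * A)^2 * cellh pt j := by
      intro j _
      have hs := Real.sq_sqrt (hm.cellh_pos j).le
      refine (pow_le_pow_left₀ (cl2_nonneg _ _ _) (hcell j) 2).trans ?_
      set a := β * Q * (2 * cl2 pt j (ξ j)) with ha
      set b := β * Q * cl2 pt (j-1) (ξ (j-1)) with hb
      set e := β * (A * √(cellh pt j)) with he
      have e1 : 12 * (β * Q)^2 * cl2 pt j (ξ j) ^ 2 = 3 * a^2 := by rw [ha]; ring
      have e2 : 3 * (β * Q)^2 * cl2 pt (j-1) (ξ (j-1)) ^ 2 = 3 * b^2 := by rw [hb]; ring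
      have e3 : 3 * (β * A)^2 * cellh pt j = 3 * e^2 := by
        calc 3 * (β * A)^2 * cellh pt j = 3 * (β * A)^2 * √(cellh pt j)^2 := by rw [hs]
          _ = 3 * e^2 := by rw [he]; ring
      rw [e1, e2, e3, mul_add, ← ha, ← hb]
      nlinarith [sq_nonneg (a - b), sq_nonneg (a - e), sq_nonneg (b - e)]
    rw [hm.sq_l2]
    refine (Finset.sum_le_sum hsq).trans_eq ?_
    rw [Finset.sum_add_distrib, Finset.sum_add_distrib, ← Finset.mul_sum, ← Finset.mul_sum,
      ← Finset.mul_sum, hshift, hm.sum_cellh, mul_pow (β * Q), hm.sq_l2 ξ]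
    ring
  have hl := l2_nonneg pt ξ
  have hle : l2 pt Z ≤ 4 * (β * Q * l2 pt ξ) + 2 * (β * A) := by
    apply le_of_sq_le_sq _ (by positivity)
    refine hsum.trans ?_
    have : 0 ≤ (β * Q * l2 pt ξ) * (β * A) := by positivity
    nlinarith [sq_nonneg (β * Q * l2 pt ξ), sq_nonneg (β * A)]
  refine hle.trans ?_
  have e : (4 * β * K₁ + 2 * β * K₂) / meshSize pt * l2 pt ξ
      + (4 * β * K₁ + 2 * β * K₂) * M * meshSize pt ^ (k+1)
      = 4 * (β * Q * l2 pt ξ) + 2 * (β * A) + (2 * β * K₂ / meshSize pt * l2 pt ξ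
        + 4 * β * K₁ * M * meshSize pt ^ (k+1)) := by
    rw [hQ, hA]
    ring
  rw [e]
  exact le_add_of_nonneg_right (by positivity)

/-- `L²` bound for the Gauss–Radau projection of a smooth function. -/
lemma exists_l2_radau_const (k : ℕ) : ∃ K : ℝ, 0 < K ∧
    ∀ (N : ℕ) (pt : Fin (N+1) → ℝ), IsMesh pt → 0 ≤ meshSize pt → ∀ (W : ℝ → ℝ) (M : ℝ),
      ContDiff ℝ (⊤ : ℕ∞) W → (∀ x, |iteratedDeriv (k+1) W x| ≤ M) →
      ∀ (q : Fin N → ℝ[X]), (∀ j, IsGRProj k (ptL pt j) (ptR pt j) W (q j)) →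
        l2 pt q ≤ K * M * meshSize pt ^ (k+1) + K * fl2 W := by
  obtain ⟨K, hK, happ⟩ := exists_mesh_radau_const k
  refine ⟨2 * K + 2, by positivity, fun N pt hm hh W M hW hM q hq => ?_⟩
  have hM0 : 0 ≤ M := (abs_nonneg _).trans (hM 0)
  have hWc : Continuous W := hW.continuous
  set A : ℝ := K * M * meshSize pt ^ (k+1) with hA
  have hA0 : 0 ≤ A := by positivity
  have hf0 : 0 ≤ fl2 W := Real.sqrt_nonneg _
  have hf : fl2 W ^ 2 = ∫ x in (0:ℝ)..1, W x ^ 2 :=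
    Real.sq_sqrt (intervalIntegral.integral_nonneg zero_le_one fun x _ => sq_nonneg _)
  have hsq : ∀ j ∈ (Finset.univ : Finset (Fin N)), cl2 pt j (q j) ^ 2 ≤
      2 * A^2 * cellh pt j + 2 * ∫ x in (ptL pt j)..(ptR pt j), W x ^ 2 := by
    intro j _
    have h1 := happ N pt hm W M hW hM q hq j
    have h2 : cl2 pt j (q j) ^ 2
        ≤ ∫ x in (ptL pt j)..(ptR pt j), (2 * ((q j).eval x - W x)^2 + 2 * W x ^ 2) := by
      rw [hm.sq_cl2]
      apply intervalIntegral.integral_mono_on (hm.ptL_lt_ptR j).le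
        (Continuous.intervalIntegrable (by fun_prop) _ _)
        (Continuous.intervalIntegrable (by fun_prop) _ _)
      intro x _
      nlinarith [sq_nonneg (((q j).eval x - W x) - W x)]
    rw [intervalIntegral.integral_add (Continuous.intervalIntegrable (by fun_prop) _ _)
      (Continuous.intervalIntegrable (by fun_prop) _ _), intervalIntegral.integral_const_mul,
      intervalIntegral.integral_const_mul] at h2
    linarith
  have hsum : l2 pt q ^ 2 ≤ 2 * A^2 + 2 * fl2 W ^ 2 := by
    rw [hm.sq_l2, hf, ← hm.sum_integral (by fun_prop)]
    refine (Finset.sum_le_sum hsq).trans_eq ?_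
    rw [Finset.sum_add_distrib, ← Finset.mul_sum, ← Finset.mul_sum, hm.sum_cellh, mul_one]
  have hle : l2 pt q ≤ 2 * A + 2 * fl2 W := by
    apply le_of_sq_le_sq _ (by positivity)
    nlinarith [mul_nonneg hA0 hf0, sq_nonneg A, sq_nonneg (fl2 W)]
  have h3 : 0 ≤ M * meshSize pt ^ (k+1) := by positivity
  have h4 : (2 * K + 2) * M * meshSize pt ^ (k+1) = 2 * A + 2 * (M * meshSize pt ^ (k+1)) := by
    rw [hA]
    ring
  rw [h4]
  nlinarith [mul_nonneg hK.le hf0]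

lemma IsOEDGStep.memVk [NeZero N] {k s : ℕ} {c d : ℕ → ℕ → ℝ} {τ β : ℝ} {pt : Fin (N+1) → ℝ}
    {Pc : Fin N → ℕ → ℝ[X] → ℝ[X]} {L Fτ : (Fin N → ℝ[X]) → (Fin N → ℝ[X])}
    {un : Fin N → ℝ[X]} {uh uσ : ℕ → Fin N → ℝ[X]} (hL : IsDGOp k pt β L)
    (hF : IsOEOp k pt (fun _ => β) Pc τ Fτ) (hun : MemVk k un)
    (h : IsOEDGStep s c d τ L Fτ un uh uσ) {m : ℕ} (hm : m ≤ s) : MemVk k (uσ m) := by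
  induction m using Nat.strong_induction_on with
  | _ m ih =>
  rcases m with _ | ℓ
  · rw [h.1]
    exact hun
  · have huh : MemVk k (uh (ℓ+1)) := by
      rw [(h.2 ℓ (by omega)).1]
      intro j
      refine natDegree_sum_le_of_forall_le _ _ fun m hm' => ?_
      have hV := ih m (mem_range.1 hm') (by have := mem_range.1 hm'; omega)
      exact (natDegree_add_le _ _).trans (max_le ((natDegree_C_mul_le _ _).trans (hV j))
        ((natDegree_C_mul_le _ _).trans ((hL _ hV).1 j)))
    obtain ⟨w, hw, hwe⟩ := hF _ huh
    rw [(h.2 ℓ (by omega)).2, hwe]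
    exact fun j => hw.2.1 τ j

/-- The stage relation of the reference functions, including the final stage. -/
lemma UrefS_succ {u : ℝ → ℝ → ℝ} {c d : ℕ → ℕ → ℝ} {β τ : ℝ} {s n ℓ : ℕ} (hτ : τ ≠ 0) :
    UrefS u c d β τ s n (ℓ+1) = fun x =>
      (∑ m ∈ range (ℓ+1), (c ℓ m * Uref u c d β τ n m x
        + -(τ * d ℓ m * β) * deriv (Uref u c d β τ n m) x))
      + (if ℓ + 1 = s then τ else 0) * rkRes u c d β τ s n x := by
  have hsum : ∀ x, (∑ m ∈ range (ℓ+1), (c ℓ m * Uref u c d β τ n m x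
        + -(τ * d ℓ m * β) * deriv (Uref u c d β τ n m) x)) = Uref u c d β τ n (ℓ+1) x := by
    intro x
    rw [Uref_succ]
    exact Finset.sum_congr rfl fun m _ => by ring
  funext x
  rw [hsum, UrefS]
  by_cases h : ℓ + 1 = s
  · rw [if_pos h, if_pos h, rkRes_eq (by omega), h]
    field_simp
    ring
  · rw [if_neg h, if_neg h, zero_mul, add_zero]

/-- The error equation of one Runge–Kutta stage. -/
lemma stage_error_equation [NeZero N] {k s : ℕ} {c d : ℕ → ℕ → ℝ} {β τ : ℝ} {n : ℕ}
    {u : ℝ → ℝ → ℝ} {pt : Fin (N+1) → ℝ} (hm : IsMesh pt) (hτ : τ ≠ 0)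
    (hU : ∀ m < s, ContDiff ℝ (⊤ : ℕ∞) (Uref u c d β τ n m))
    (hρ : Continuous (rkRes u c d β τ s n))
    {Pstar : (ℝ → ℝ) → Fin N → ℝ[X]}
    (hP : ∀ W : ℝ → ℝ, Continuous W → ∀ j, IsGRProj k (ptL pt j) (ptR pt j) W (Pstar W j))
    (L : (Fin N → ℝ[X]) → (Fin N → ℝ[X])) (uσ : ℕ → Fin N → ℝ[X]) {ℓ : ℕ} (hℓ : ℓ < s)
    (j : Fin N) :
    rkStage c d τ L uσ ℓ j - Pstar (UrefS u c d β τ s n (ℓ+1)) j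
      = (∑ m ∈ range (ℓ+1), (C (c ℓ m) * (uσ m j - Pstar (UrefS u c d β τ s n m) j)
          + C (τ * d ℓ m) * (L (uσ m) j + C β * Pstar (deriv (Uref u c d β τ n m)) j)))
        + C (-(if ℓ + 1 = s then τ else 0)) * Pstar (rkRes u c d β τ s n) j := by
  have hlt : ∀ m ∈ range (ℓ+1), m < s := fun m hm' => by
    have := mem_range.1 hm'
    omega
  have hUc : ∀ m ∈ range (ℓ+1), Continuous (Uref u c d β τ n m) :=
    fun m hm' => (hU m (hlt m hm')).continuous
  have hUd : ∀ m ∈ range (ℓ+1), Continuous (deriv (Uref u c d β τ n m)) :=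
    fun m hm' => (ContDiff.iterate_deriv 1 (hU m (hlt m hm'))).continuous
  have hcs : ∀ m ∈ range (ℓ+1), Continuous fun x => c ℓ m * Uref u c d β τ n m x
      + -(τ * d ℓ m * β) * deriv (Uref u c d β τ n m) x := fun m hm' =>
    (continuous_const.mul (hUc m hm')).add (continuous_const.mul (hUd m hm'))
  have hGR := (IsGRProj.sum (s := range (ℓ+1)) hcs fun m hm' =>
    IsGRProj.add (continuous_const.mul (hUc m hm')) (continuous_const.mul (hUd m hm'))
      ((hP _ (hUc m hm') j).const_mul (c ℓ m))
      ((hP _ (hUd m hm') j).const_mul (-(τ * d ℓ m * β)))).add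
    (w₂ := fun x => (if ℓ + 1 = s then τ else 0) * rkRes u c d β τ s n x)
    (continuous_finsetSum _ hcs) (continuous_const.mul hρ)
    ((hP _ hρ j).const_mul (if ℓ + 1 = s then τ else 0))
  have hcont : Continuous (UrefS u c d β τ s n (ℓ+1)) := by
    rw [UrefS_succ hτ]
    exact (continuous_finsetSum _ hcs).add (continuous_const.mul hρ)
  rw [← UrefS_succ hτ] at hGR
  rw [(hP _ hcont j).unique (hm.ptL_lt_ptR j) hcont hGR, rkStage, ← sub_sub,
    ← Finset.sum_sub_distrib, C_neg, neg_mul, ← sub_eq_add_neg]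
  congr 1
  refine Finset.sum_congr rfl fun m hm' => ?_
  rw [UrefS, if_neg (hlt m hm').ne]
  simp only [C_mul, C_neg]
  ring

/-- Lemma on stage errors, 1D case; Lemma 4.3 "xi-xis".  Under
quasi-uniformity and the CFL condition `τ ≤ C_CFL h^κ`, `κ ≥ 1`, there is a constant
`C` independent of `h, τ, n` such that for every `0 ≤ ℓ ≤ s-1`,
`‖ξ^{n,ℓ+1}‖ ≤ C ∑_{0≤m≤ℓ} ‖ξ_σ^{n,m}‖ + C τ (h^{k+1} + τ^r)`,
where `ξ^{n,m} = u_h^{n,m} - P* U^{n,m}` and `ξ_σ^{n,m} = u_σ^{n,m} - P* U^{n,m}`. -/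
theorem stage_error_estimate
    (k s r : ℕ) (hs : 1 ≤ s)
    (c d : ℕ → ℕ → ℝ) (hc : ∀ ℓ < s, ∑ m ∈ Finset.range (ℓ+1), c ℓ m = 1)
    (β γ CCFL κ Cr : ℝ)
    (hβ : 0 < β) (hγ : 1 ≤ γ) (hCCFL : 0 < CCFL) (hκ : 1 ≤ κ) (hCr : 0 ≤ Cr)
    (u : ℝ → ℝ → ℝ) (hu : IsSmoothSolution β u) :
    ∃ C : ℝ, 0 < C ∧
      ∀ (N : ℕ) [NeZero N] (pt : Fin (N+1) → ℝ),
        IsMesh pt → QuasiUniform pt γ → meshSize pt ≤ 1 →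
      ∀ τ : ℝ, 0 < τ → τ ≤ 1 → τ ≤ CCFL * meshSize pt ^ κ →
      ∀ n : ℕ, fl2 (rkRes u c d β τ s n) ≤ Cr * τ ^ r →
      ∀ Pstar : (ℝ → ℝ) → Fin N → Polynomial ℝ,
        (∀ W : ℝ → ℝ, Continuous W → ∀ j,
          IsGRProj k (ptL pt j) (ptR pt j) W (Pstar W j)) →
      ∀ Pc : Fin N → ℕ → Polynomial ℝ → Polynomial ℝ, IsCellProj pt Pc →
      ∀ L Fτ : (Fin N → Polynomial ℝ) → (Fin N → Polynomial ℝ),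
        IsDGOp k pt β L → IsOEOp k pt (fun _ => β) Pc τ Fτ →
      ∀ (un : Fin N → Polynomial ℝ) (uh uσ : ℕ → Fin N → Polynomial ℝ),
        MemVk k un → IsOEDGStep s c d τ L Fτ un uh uσ →
      ∀ ℓ < s,
        l2 pt (fun j => uh (ℓ+1) j - Pstar (UrefS u c d β τ s n (ℓ+1)) j)
          ≤ C * (∑ m ∈ Finset.range (ℓ+1),
              l2 pt (fun j => uσ m j - Pstar (UrefS u c d β τ s n m) j))
            + C * τ * (meshSize pt ^ (k+1) + τ ^ r) := by
  obtain ⟨A, hA, hdg⟩ := exists_dg_residual_const k hβ hγ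
  obtain ⟨R, hR, hrad⟩ := exists_l2_radau_const k
  have hUs : ∀ m ∈ range s, UniformlySmooth (fun i : StepParam => Uref u c d β i.1 i.2 m) :=
    fun m hm => uniformlySmooth_Uref hu hc (mem_range.1 hm).le
  choose! M hM using fun m hm => (hUs m hm).deriv.2.2 (k+1)
  have hρs : UniformlySmooth (fun i : StepParam => rkRes u c d β i.1 s i.2) :=
    uniformlySmooth_rkRes (d := d) hβ hs hu hc
  obtain ⟨B, hB⟩ := hρs.2.2 (k+1)
  have hB0 : 0 ≤ B := (abs_nonneg _).trans (hB (⟨1, by simp⟩, 0) 0)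
  set M₀ : ℝ := ∑ m ∈ range s, |M m| with hM₀
  set S : ℝ := ∑ ℓ ∈ range s, ∑ m ∈ range s, (|c ℓ m| + |d ℓ m|) with hS
  have hM₀0 : 0 ≤ M₀ := by positivity
  have hS0 : 0 ≤ S := by positivity
  have hcd : ∀ ℓ < s, ∀ m < s, |c ℓ m| + |d ℓ m| ≤ S := fun ℓ hℓ m hm =>
    (Finset.single_le_sum (f := fun m => |c ℓ m| + |d ℓ m|) (fun _ _ => by positivity)
      (mem_range.2 hm)).trans
    (Finset.single_le_sum (f := fun ℓ => ∑ m ∈ range s, (|c ℓ m| + |d ℓ m|))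
      (fun _ _ => by positivity) (mem_range.2 hℓ))
  refine ⟨S + S * A * CCFL + s * (S * A * M₀) + R * B + R * Cr + 1, by positivity, ?_⟩
  intro N _ pt hm hqu hh1 τ hτ hτ1 hcfl n hres Pstar hP Pc _ L Fτ hL hF un uh uσ hun hstep ℓ hℓ
  set h := meshSize pt with hh
  have hh0 : 0 < h := hm.meshSize_pos
  have hτh : τ ≤ CCFL * h := hcfl.trans <| mul_le_mul_of_nonneg_left (by
    simpa using Real.rpow_le_rpow_of_exponent_ge hh0 hh1 hκ) hCCFL.le
  set i : StepParam := (⟨τ, hτ, hτ1⟩, n) with hi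
  set ξ : ℕ → Fin N → ℝ[X] := fun m j => uσ m j - Pstar (UrefS u c d β τ s n m) j with hξ
  set Z : ℕ → Fin N → ℝ[X] := fun m j =>
    L (uσ m) j + C β * Pstar (deriv (Uref u c d β τ n m)) j with hZ
  set ρ : Fin N → ℝ[X] := Pstar (rkRes u c d β τ s n) with hρ
  have hρ' : l2 pt ρ ≤ R * B * h ^ (k+1) + R * (Cr * τ ^ r) :=
    (hrad N pt hm hh0.le _ B (hρs.1 i) (hB i) ρ (hP _ (hρs.continuous i))).trans
      (by gcongr)
  have hZ' : ∀ m < s, l2 pt (Z m) ≤ A / h * l2 pt (ξ m) + A * M₀ * h ^ (k+1) := by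
    intro m hms
    have hmr := mem_range.2 hms
    have hU := hUs m hmr
    have hξm : ξ m = fun j => uσ m j - Pstar (Uref u c d β τ n m) j := by
      simp only [hξ, UrefS, if_neg hms.ne]
    rw [hξm]
    refine (hdg N pt hm hqu L hL (Uref u c d β τ n m) M₀ (hU.1 i) (hU.2.1 i) (fun x => ?_) (uσ m)
      _ _ (hstep.memVk hL hF hun hms.le) (hP _ (hU.continuous i))
      (hP _ (hU.deriv.continuous i)))
    exact (hM m hmr i x).trans ((le_abs_self _).trans
      (Finset.single_le_sum (f := fun m => |M m|) (fun _ _ => abs_nonneg _) hmr))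
  have hterm : ∀ m ∈ range (ℓ+1),
      l2 pt (fun j => C (c ℓ m) * ξ m j + C (τ * d ℓ m) * Z m j)
        ≤ (S + S * A * CCFL) * l2 pt (ξ m) + τ * (S * A * M₀ * h ^ (k+1)) := by
    intro m hmr
    have hms : m < s := by
      have := mem_range.1 hmr
      omega
    have hξ0 := l2_nonneg pt (ξ m)
    have hle := hcd ℓ hℓ m hms
    have hcS : |c ℓ m| ≤ S := by linarith [abs_nonneg (d ℓ m)]
    have hdS : |d ℓ m| ≤ S := by linarith [abs_nonneg (c ℓ m)]
    refine (hm.l2_add_le _ _).trans ?_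
    rw [l2_C_mul, l2_C_mul, abs_mul, abs_of_pos hτ]
    calc |c ℓ m| * l2 pt (ξ m) + τ * |d ℓ m| * l2 pt (Z m)
        ≤ S * l2 pt (ξ m) + τ * S * (A / h * l2 pt (ξ m) + A * M₀ * h ^ (k+1)) := by
          gcongr
          · exact l2_nonneg _ _
          · exact hZ' m hms
      _ = S * l2 pt (ξ m) + τ / h * (S * A * l2 pt (ξ m)) + τ * (S * A * M₀ * h ^ (k+1)) := by
          ring
      _ ≤ S * l2 pt (ξ m) + CCFL * (S * A * l2 pt (ξ m)) + τ * (S * A * M₀ * h ^ (k+1)) := by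
          gcongr
          exact (div_le_iff₀ hh0).2 hτh
      _ = _ := by ring
  have herr : (fun j => uh (ℓ+1) j - Pstar (UrefS u c d β τ s n (ℓ+1)) j) = fun j =>
      (∑ m ∈ range (ℓ+1), (C (c ℓ m) * ξ m j + C (τ * d ℓ m) * Z m j))
        + C (-(if ℓ + 1 = s then τ else 0)) * ρ j := by
    funext j
    rw [(hstep.2 ℓ hℓ).1]
    exact stage_error_equation hm hτ.ne' (fun m hms => (hUs m (mem_range.2 hms)).1 i)
      (hρs.continuous i) hP L uσ hℓ j
  have habs : |-(if ℓ + 1 = s then τ else 0)| ≤ τ := by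
    split_ifs
    · rw [abs_neg, abs_of_pos hτ]
    · simpa using hτ.le
  have hcard : ((ℓ + 1 : ℕ) : ℝ) ≤ s := by exact_mod_cast hℓ
  set X : ℝ := ∑ m ∈ range (ℓ+1), l2 pt (ξ m) with hX
  have hX0 : 0 ≤ X := Finset.sum_nonneg fun m _ => l2_nonneg pt (ξ m)
  rw [herr]
  calc _ ≤ (∑ m ∈ range (ℓ+1), ((S + S * A * CCFL) * l2 pt (ξ m)
          + τ * (S * A * M₀ * h ^ (k+1)))) + τ * (R * B * h ^ (k+1) + R * (Cr * τ ^ r)) := by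
        refine (hm.l2_add_le _ _).trans (add_le_add ((hm.l2_sum_le _ fun m j =>
          C (c ℓ m) * ξ m j + C (τ * d ℓ m) * Z m j).trans (Finset.sum_le_sum hterm)) ?_)
        rw [l2_C_mul]
        exact mul_le_mul habs hρ' (l2_nonneg _ _) hτ.le
    _ = (S + S * A * CCFL) * X + ((ℓ + 1 : ℕ) : ℝ) * (τ * (S * A * M₀ * h ^ (k+1)))
          + τ * (R * B * h ^ (k+1) + R * (Cr * τ ^ r)) := by
        rw [Finset.sum_add_distrib, ← Finset.mul_sum, Finset.sum_const, card_range, nsmul_eq_mul]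
    _ ≤ (S + S * A * CCFL) * X + s * (τ * (S * A * M₀ * h ^ (k+1)))
          + τ * (R * B * h ^ (k+1) + R * (Cr * τ ^ r)) := by gcongr
    _ ≤ _ := by
        rw [← sub_nonneg]
        have e : 0 ≤ (s * (S * A * M₀) + R * B + R * Cr + 1) * X
            + τ * ((S + S * A * CCFL + R * Cr + 1) * h ^ (k+1)
              + (S + S * A * CCFL + s * (S * A * M₀) + R * B + 1) * τ ^ r) := by positivity
        refine e.trans_eq ?_
        ring

end OEDG
end

section
/- (Lemma 4.7, 1D case, d = 1.) Let u_h ∈ V^k, let U be a C^{k+1} periodic function on Ω, and set ξ = u_h − P*U. If ‖ξ‖_{L∞(Ω)} ≤ h ≤ 1, then there is a constant C, depending only on k and on the C^{k+1} norm of U, such that for every cell I_j and every 0 ≤ m ≤ k: ‖u_h − P^{m−1}u_h‖_{L²(I_j)} ≤ C h^{3/2}. -/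
open Polynomial Finset MeasureTheory

namespace OEDG

variable {N : ℕ}

open Set in
/-- On polynomials of degree at most `n`, the sup norm over `[0,1]` is controlled by the `L²` norm
with weight `s`. -/
lemma exists_sq_eval_le_weighted_integral (n : ℕ) :
    ∃ K : ℝ, 0 < K ∧ ∀ r : Polynomial ℝ, r.natDegree ≤ n → ∀ t ∈ Icc (0:ℝ) 1,
      r.eval t ^ 2 ≤ K * ∫ s in (0:ℝ)..1, s * r.eval s ^ 2 := by
  let F : (Fin (n+1) → ℝ) → ℝ := fun c =>
    ∫ s in (0:ℝ)..1, s * (∑ i, c i * s ^ (i:ℕ)) ^ 2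
  have hF : Continuous F := by
    apply intervalIntegral.continuous_parametric_intervalIntegral_of_continuous'
    fun_prop
  have hpos : ∀ c, c ≠ 0 → 0 < F c := by
    intro c hc
    have hcont : Continuous fun s : ℝ => s * (∑ i, c i * s ^ (i:ℕ)) ^ 2 := by fun_prop
    have hnn : ∀ s ∈ Ioc (0:ℝ) 1, 0 ≤ s * (∑ i, c i * s ^ (i:ℕ)) ^ 2 :=
      fun s hs => mul_nonneg hs.1.le (sq_nonneg _)
    let p : Polynomial ℝ := ∑ i : Fin (n+1), C (c i) * X ^ (i:ℕ)
    have hp : p ≠ 0 := by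
      intro h0
      apply hc
      ext i
      have := congrArg (fun q : Polynomial ℝ => q.coeff (i:ℕ)) h0
      simpa [p, finsetSum_coeff, coeff_C_mul, coeff_X_pow, Fin.val_inj] using this
    obtain ⟨s, hs, hsp⟩ : ∃ s ∈ Icc (0:ℝ) 1, s * (∑ i, c i * s ^ (i:ℕ)) ^ 2 ≠ 0 := by
      by_contra! hall
      refine hp (p.eq_zero_of_infinite_isRoot
        ((Ioc_infinite (zero_lt_one' ℝ)).mono fun s hs => ?_))
      have h := hall s ⟨hs.1.le, hs.2⟩
      have h2 : (∑ i, c i * s ^ (i:ℕ)) = 0 := by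
        simpa [hs.1.ne'] using h
      simpa [p, IsRoot, eval_finsetSum] using h2
    exact intervalIntegral.integral_pos zero_lt_one hcont.continuousOn hnn
      ⟨s, hs, lt_of_le_of_ne (mul_nonneg hs.1 (sq_nonneg _)) hsp.symm⟩
  obtain ⟨c₀, hc₀, hmin⟩ := (isCompact_sphere (0 : Fin (n+1) → ℝ) 1).exists_isMinOn
    (NormedSpace.sphere_nonempty.2 zero_le_one) hF.continuousOn
  have hδ : 0 < F c₀ := hpos c₀ (ne_zero_of_mem_unit_sphere ⟨c₀, hc₀⟩)
  refine ⟨((n:ℝ)+1) ^ 2 / F c₀, by positivity, fun r hr t ht => ?_⟩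
  let c : Fin (n+1) → ℝ := fun i => r.coeff i
  have heval : ∀ s, r.eval s = ∑ i, c i * s ^ (i:ℕ) := fun s => by
    rw [eval_eq_sum_range' (Nat.lt_succ_of_le hr), Finset.sum_range]
  have hFr : (∫ s in (0:ℝ)..1, s * r.eval s ^ 2) = F c := by
    simp only [heval, F]
  have habs : |r.eval t| ≤ ((n:ℝ)+1) * ‖c‖ := by
    rw [heval]
    calc |∑ i, c i * t ^ (i:ℕ)| ≤ ∑ i, |c i * t ^ (i:ℕ)| := Finset.abs_sum_le_sum_abs _ _
      _ ≤ ∑ _i : Fin (n+1), ‖c‖ := by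
        refine Finset.sum_le_sum fun i _ => ?_
        rw [abs_mul, abs_of_nonneg (pow_nonneg ht.1 _)]
        exact (mul_le_of_le_one_right (abs_nonneg _) (pow_le_one₀ ht.1 ht.2)).trans
          (norm_le_pi_norm c i)
      _ = ((n:ℝ)+1) * ‖c‖ := by simp
  have hlow : F c₀ * ‖c‖ ^ 2 ≤ F c := by
    rcases eq_or_ne c 0 with h0 | h0
    · simp [h0, F]
    · have hn : ‖c‖ ≠ 0 := norm_ne_zero_iff.2 h0
      have hm : F c₀ ≤ F (‖c‖⁻¹ • c) :=
        hmin (by simp [norm_smul, hn])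
      have hs : F (‖c‖⁻¹ • c) = (‖c‖⁻¹) ^ 2 * F c := by
        simp only [F, ← intervalIntegral.integral_const_mul]
        congr 1
        ext s
        simp only [Pi.smul_apply, smul_eq_mul, mul_assoc, ← Finset.mul_sum]
        ring
      rw [hs] at hm
      calc F c₀ * ‖c‖ ^ 2 ≤ (‖c‖⁻¹) ^ 2 * F c * ‖c‖ ^ 2 := by gcongr
        _ = F c := by field_simp
  rw [hFr, div_mul_eq_mul_div, le_div_iff₀ hδ]
  calc r.eval t ^ 2 * F c₀ ≤ (((n:ℝ)+1) * ‖c‖) ^ 2 * F c₀ := by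
        rw [← sq_abs]; gcongr
    _ = ((n:ℝ)+1) ^ 2 * (F c₀ * ‖c‖ ^ 2) := by ring
    _ ≤ ((n:ℝ)+1) ^ 2 * F c := by gcongr

open Set in
/-- Scaled version of `exists_sq_eval_le_weighted_integral` on an interval `[a,b]`. -/
lemma exists_sq_eval_le_weighted_integral_Icc (n : ℕ) :
    ∃ K : ℝ, 0 < K ∧ ∀ r : Polynomial ℝ, r.natDegree ≤ n → ∀ a b : ℝ, a < b →
      ∀ x ∈ Icc a b,
        r.eval x ^ 2 * (b - a) ^ 2 ≤ K * ∫ y in a..b, (b - y) * r.eval y ^ 2 := by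
  obtain ⟨K, hK, h⟩ := exists_sq_eval_le_weighted_integral n
  refine ⟨K, hK, fun r hr a b hab x hx => ?_⟩
  have hh : 0 < b - a := sub_pos.2 hab
  have hdeg : (r.comp (C b - C (b - a) * X)).natDegree ≤ n := by
    refine natDegree_comp_le.trans ((Nat.mul_le_mul hr ?_).trans_eq (mul_one n))
    compute_degree
  have key := h _ hdeg ((b - x) / (b - a))
    ⟨div_nonneg (sub_nonneg.2 hx.2) hh.le, (div_le_one hh).2 (by linarith [hx.1])⟩
  have hsub := intervalIntegral.integral_comp_sub_mul (a := 0) (b := 1)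
    (fun y => (b - y) * r.eval y ^ 2) hh.ne' b
  simp only [mul_one, mul_zero, sub_zero, sub_sub_cancel, smul_eq_mul] at hsub
  have hx' : b - (b - a) * ((b - x) / (b - a)) = x := by field_simp; ring
  simp only [eval_comp, eval_sub, eval_C, eval_mul, eval_X, hx'] at key
  have hI : (∫ s in (0:ℝ)..1, (b - a) * s * r.eval (b - (b - a) * s) ^ 2)
      = (b - a) * ∫ s in (0:ℝ)..1, s * r.eval (b - (b - a) * s) ^ 2 := by
    simp only [mul_assoc, intervalIntegral.integral_const_mul]
  rw [hI] at hsub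
  have hJ : (∫ y in a..b, (b - y) * r.eval y ^ 2)
      = (b - a) ^ 2 * ∫ s in (0:ℝ)..1, s * r.eval (b - (b - a) * s) ^ 2 := by
    rw [sq, mul_assoc, hsub, mul_inv_cancel_left₀ hh.ne']
  rw [hJ]
  calc r.eval x ^ 2 * (b - a) ^ 2
      ≤ (K * ∫ s in (0:ℝ)..1, s * r.eval (b - (b - a) * s) ^ 2) * (b - a) ^ 2 := by gcongr
    _ = _ := by ring

open Set in
/-- The Gauss–Radau projection is bounded in the sup norm, relative to the value at the right
endpoint. -/
lemma exists_abs_eval_sub_le_of_isGRProj (k : ℕ) :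
    ∃ K : ℝ, 0 < K ∧ ∀ (a b : ℝ) (w : ℝ → ℝ) (p : Polynomial ℝ) (W : ℝ), a < b →
      Continuous w → IsGRProj k a b w p → (∀ x ∈ Icc a b, |w x - w b| ≤ W) →
      ∀ x ∈ Icc a b, |p.eval x - w b| ≤ K * W := by
  obtain ⟨K, hK, h⟩ := exists_sq_eval_le_weighted_integral_Icc k
  refine ⟨K, hK, fun a b w p W hab hw hp hW x hx => ?_⟩
  obtain ⟨hdeg, horth, hend⟩ := hp
  have hh : 0 < b - a := sub_pos.2 hab
  have hW0 : 0 ≤ W := (abs_nonneg _).trans (hW b ⟨hab.le, le_rfl⟩)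
  obtain ⟨r, hr⟩ : X - C b ∣ p - C (w b) := by
    rw [dvd_iff_isRoot]; simp [hend]
  have hpe : ∀ y, p.eval y - w b = (y - b) * r.eval y := fun y => by
    have := congrArg (eval y) hr
    simpa using this
  rcases eq_or_ne r 0 with hr0 | hr0
  · rw [hpe, hr0]; simpa using mul_nonneg hK.le hW0
  have hrdeg : r.natDegree < k := by
    have h1 : (p - C (w b)).natDegree = 1 + r.natDegree := by
      rw [hr, natDegree_mul (X_sub_C_ne_zero b) hr0, natDegree_X_sub_C]
    have h2 : (p - C (w b)).natDegree ≤ k := by rwa [natDegree_sub_C]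
    lia
  obtain ⟨z, hz, hmax⟩ := isCompact_Icc.exists_isMaxOn (nonempty_Icc.2 hab.le)
    (f := fun y => |r.eval y|) (by fun_prop)
  have hS : ∀ y ∈ Icc a b, |r.eval y| ≤ |r.eval z| := fun y hy => hmax hy
  have hint : (∫ y in a..b, (b - y) * r.eval y ^ 2)
      = -∫ y in a..b, (w y - w b) * r.eval y := by
    have h0 := horth r hrdeg
    have hsplit : ∀ y, (w y - p.eval y) * r.eval y
        = (w y - w b) * r.eval y + (b - y) * r.eval y ^ 2 := fun y => by
      linear_combination -(r.eval y) * hpe y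
    simp only [hsplit] at h0
    rw [intervalIntegral.integral_add
      (Continuous.intervalIntegrable (by fun_prop) _ _)
      (Continuous.intervalIntegrable (by fun_prop) _ _)] at h0
    linarith
  have hbound : (∫ y in a..b, (b - y) * r.eval y ^ 2) ≤ W * |r.eval z| * (b - a) := by
    rw [hint]
    refine (neg_le_abs _).trans ?_
    rw [← Real.norm_eq_abs, ← abs_of_pos hh]
    refine intervalIntegral.norm_integral_le_of_norm_le_const fun y hy => ?_
    rw [uIoc_of_le hab.le] at hy
    have hy' : y ∈ Icc a b := Ioc_subset_Icc_self hy
    rw [Real.norm_eq_abs, abs_mul]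
    exact mul_le_mul (hW y hy') (hS y hy') (abs_nonneg _) hW0
  have hz2 := h r hrdeg.le a b hab z hz
  have hmain : (b - a) * |r.eval z| ≤ K * W := by
    rcases (abs_nonneg (r.eval z)).eq_or_lt with h0 | h0
    · rw [← h0, mul_zero]; positivity
    · refine le_of_mul_le_mul_right ?_ (mul_pos h0 hh)
      calc (b - a) * |r.eval z| * (|r.eval z| * (b - a))
          = r.eval z ^ 2 * (b - a) ^ 2 := by rw [← sq_abs (r.eval z)]; ring
        _ ≤ K * (W * |r.eval z| * (b - a)) := hz2.trans (by gcongr)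
        _ = K * W * (|r.eval z| * (b - a)) := by ring
  rw [hpe, abs_mul, abs_sub_comm, abs_of_nonneg (sub_nonneg.2 hx.2)]
  exact (mul_le_mul (by linarith [hx.1]) (hS x hx) (abs_nonneg _) hh.le).trans hmain

/-- Best approximation property of the cellwise `L²` projection. -/
lemma IsCellProj.cip_sub_le {pt : Fin (N+1) → ℝ}
    {Pc : Fin N → ℕ → Polynomial ℝ → Polynomial ℝ} (hPc : IsCellProj pt Pc) {j : Fin N}
    (hj : ptL pt j ≤ ptR pt j) (d : ℕ) (p q : Polynomial ℝ) (hq : q.natDegree ≤ d) :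
    cip pt j (p - Pc j d p) (p - Pc j d p) ≤ cip pt j (p - q) (p - q) := by
  obtain ⟨hdeg, horth⟩ := hPc j d p
  have h0 := horth (Pc j d p - q) ((natDegree_sub_le _ _).trans (max_le hdeg hq))
  have hnn : 0 ≤ cip pt j (Pc j d p - q) (Pc j d p - q) :=
    intervalIntegral.integral_nonneg hj fun x _ => mul_self_nonneg _
  have hexp : cip pt j (p - q) (p - q) = cip pt j (p - Pc j d p) (p - Pc j d p)
      + 2 * cip pt j (p - Pc j d p) (Pc j d p - q)
      + cip pt j (Pc j d p - q) (Pc j d p - q) := by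
    unfold cip
    rw [← intervalIntegral.integral_const_mul, ← intervalIntegral.integral_add
      (Continuous.intervalIntegrable (by fun_prop) _ _)
      (Continuous.intervalIntegrable (by fun_prop) _ _), ← intervalIntegral.integral_add
      (Continuous.intervalIntegrable (by fun_prop) _ _)
      (Continuous.intervalIntegrable (by fun_prop) _ _)]
    congr 1
    ext x
    simp only [eval_sub]
    ring
  rw [hexp, h0]
  linarith

/-- Pointwise values are bounded by the sup norm. -/
lemma abs_eval_sub_le_linfSub (pt : Fin (N+1) → ℝ) (u : Fin N → Polynomial ℝ) (c : ℝ)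
    (j : Fin N) {x : ℝ} (hx : x ∈ Set.Icc (ptL pt j) (ptR pt j)) :
    |(u j).eval x - c| ≤ linfSub pt u c := by
  have h1 : |(u j).eval x - c| ≤
      sSup ((fun x => |(u j).eval x - c|) '' Set.Icc (ptL pt j) (ptR pt j)) :=
    le_csSup (isCompact_Icc.bddAbove_image (by fun_prop)) ⟨x, hx, rfl⟩
  exact h1.trans (le_ciSup (f := fun j : Fin N =>
    sSup ((fun x => |(u j).eval x - c|) '' Set.Icc (ptL pt j) (ptR pt j)))
    (Set.finite_range _).bddAbove j)

/-- Lemma 4.7, 1D case, `d = 1`.  Let `u_h ∈ V^k`, `U` a `C^{k+1}`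
periodic function with `C^{k+1}` norm bounded by `M`, and `ξ = u_h - P*U`.  If
`‖ξ‖_{L∞(Ω)} ≤ h ≤ 1`, then there is `C` depending only on `k` and `M` such that for
every cell `I_j` and every `0 ≤ m ≤ k`, `‖u_h - P^{m-1} u_h‖_{L²(I_j)} ≤ C h^{3/2}`. -/
theorem proj_deviation_estimate
    (k : ℕ) (M : ℝ) (hM : 0 ≤ M) :
    ∃ C : ℝ, 0 < C ∧
      ∀ (N : ℕ) [NeZero N] (pt : Fin (N+1) → ℝ), IsMesh pt →
      ∀ U : ℝ → ℝ, ContDiff ℝ (k+1) U → Function.Periodic U 1 →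
        (∀ m : ℕ, m ≤ k+1 → ∀ x : ℝ, |iteratedDeriv m U x| ≤ M) →
      ∀ uh : Fin N → Polynomial ℝ, MemVk k uh →
      ∀ PU : Fin N → Polynomial ℝ,
        (∀ j, IsGRProj k (ptL pt j) (ptR pt j) U (PU j)) →
      linfSub pt (fun i => uh i - PU i) 0 ≤ meshSize pt → meshSize pt ≤ 1 →
      ∀ Pc : Fin N → ℕ → Polynomial ℝ → Polynomial ℝ, IsCellProj pt Pc →
      ∀ (j : Fin N) (m : ℕ), m ≤ k →
        cl2 pt j (uh j - Pc j (m-1) (uh j)) ≤ C * meshSize pt ^ ((3:ℝ)/2) := by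
  obtain ⟨K, hK, hGR⟩ := exists_abs_eval_sub_le_of_isGRProj k
  refine ⟨1 + K * M, by positivity, ?_⟩
  intro N _ pt hpt U hU _ hUM uh _ PU hPU hξ _ Pc hPc j m _
  have hlt : ptL pt j < ptR pt j := hpt.2.2 Fin.castSucc_lt_succ
  have hcell : ptR pt j - ptL pt j ≤ meshSize pt :=
    le_ciSup (f := cellh pt) (Set.finite_range _).bddAbove j
  have hh : 0 < meshSize pt := (sub_pos.2 hlt).trans_le hcell
  have hUdiff : Differentiable ℝ U := hU.differentiable (by simp)
  have hUlip : ∀ x ∈ Set.Icc (ptL pt j) (ptR pt j),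
      |U x - U (ptR pt j)| ≤ M * meshSize pt := fun x hx => by
    have h := convex_univ.norm_image_sub_le_of_norm_deriv_le (f := U) (C := M)
      (fun y _ => hUdiff y)
      (fun y _ => by simpa [iteratedDeriv_one] using hUM 1 (by lia) y)
      (Set.mem_univ (ptR pt j)) (Set.mem_univ x)
    rw [Real.norm_eq_abs, Real.norm_eq_abs, abs_sub_comm x,
      abs_of_nonneg (sub_nonneg.2 hx.2)] at h
    exact h.trans (mul_le_mul_of_nonneg_left (by linarith [hx.1]) hM)
  have hdev : ∀ x ∈ Set.Icc (ptL pt j) (ptR pt j),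
      |(uh j - C (U (ptR pt j))).eval x| ≤ (1 + K * M) * meshSize pt := fun x hx => by
    have h1 := (abs_eval_sub_le_linfSub pt (fun i => uh i - PU i) 0 j hx).trans hξ
    have h2 := hGR _ _ U (PU j) _ hlt hUdiff.continuous (hPU j) hUlip x hx
    rw [eval_sub, sub_zero] at h1
    rw [eval_sub, eval_C, ← sub_add_sub_cancel _ ((PU j).eval x)]
    exact (abs_add_le _ _).trans (by linarith)
  have hcip : cip pt j (uh j - C (U (ptR pt j))) (uh j - C (U (ptR pt j)))
      ≤ ((1 + K * M) * meshSize pt) ^ 2 * meshSize pt := by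
    refine (Real.le_norm_self _).trans ?_
    refine (intervalIntegral.norm_integral_le_of_norm_le_const (E := ℝ)
      (C := ((1 + K * M) * meshSize pt) ^ 2) fun x hx => ?_).trans ?_
    · rw [Set.uIoc_of_le hlt.le] at hx
      rw [← sq, norm_pow, Real.norm_eq_abs]
      exact pow_le_pow_left₀ (abs_nonneg _) (hdev x (Set.Ioc_subset_Icc_self hx)) 2
    · rw [abs_of_pos (sub_pos.2 hlt)]
      gcongr
  refine Real.sqrt_le_iff.2 ⟨by positivity, ?_⟩
  refine ((hPc.cip_sub_le hlt.le (m-1) (uh j) _ (by simp)).trans hcip).trans_eq ?_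
  rw [mul_pow, mul_pow, ← Real.rpow_mul_natCast hh.le, mul_assoc, ← pow_succ,
    ← Real.rpow_natCast _ (2+1)]
  norm_num
end OEDG
end
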